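/- arXiv:1309.4650 — 9 statements merged into one kernel-verified Lean document; each statement's English description precedes it below -/
import Mathlib

section
/- Let T, η, α be real constants with 0 < η < T and αη ≠ 1, and let y : [0,T] → ℝ be continuous. Then the function u : [0,T] → ℝ defined by u(t) = (1/(1−αη))∫₀^T (T−s)y(s) ds − (α/(2(1−αη)))∫₀^η (η−s)² y(s) ds − ∫₀^t (t−s)y(s) ds is twice differentiable and satisfies u''(t) + y(t) = 0 for all t ∈ (0,T), u'(0) = 0, and u(T) = α ∫₀^η u(s) ds. -/
open Set MeasureTheory Filter

noncomputable section

/-- `u` is a solution of the linear BVP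
`u''(t) + y(t) = 0` on `(0,T)`, `u'(0) = 0`, `u(T) = α ∫₀^η u(s) ds`,
where derivatives are taken within `[0,T]`. -/
def IsLinBVPSol (T η α : ℝ) (y u : ℝ → ℝ) : Prop :=
  ∃ u' u'' : ℝ → ℝ,
    (∀ t ∈ Icc (0:ℝ) T, HasDerivWithinAt u (u' t) (Icc (0:ℝ) T) t) ∧
    (∀ t ∈ Icc (0:ℝ) T, HasDerivWithinAt u' (u'' t) (Icc (0:ℝ) T) t) ∧
    (∀ t ∈ Ioo (0:ℝ) T, u'' t + y t = 0) ∧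
    u' 0 = 0 ∧
    u T = α * ∫ s in (0:ℝ)..η, u s

lemma hasDerivAt_integral_of_continuous {f : ℝ → ℝ} (hf : Continuous f) (t : ℝ) :
    HasDerivAt (fun x => ∫ s in (0:ℝ)..x, f s) (f t) t :=
  intervalIntegral.integral_hasDerivAt_right (hf.intervalIntegrable _ _)
    (hf.stronglyMeasurableAtFilter _ _) hf.continuousAt

lemma integral_sub_mul {z : ℝ → ℝ} (hz : Continuous z) (t : ℝ) :
    ∫ s in (0:ℝ)..t, (t - s) * z s =
      t * (∫ s in (0:ℝ)..t, z s) - ∫ s in (0:ℝ)..t, s * z s := by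
  rw [← intervalIntegral.integral_const_mul, ← intervalIntegral.integral_sub
    (Continuous.intervalIntegrable (by fun_prop) _ _)
    (Continuous.intervalIntegrable (by fun_prop) _ _)]
  simp only [sub_mul]

lemma hasDerivAt_integral_sub_mul {z : ℝ → ℝ} (hz : Continuous z) (t : ℝ) :
    HasDerivAt (fun x => ∫ s in (0:ℝ)..x, (x - s) * z s) (∫ s in (0:ℝ)..t, z s) t := by
  rw [funext (integral_sub_mul hz)]
  refine HasDerivAt.congr_deriv (((hasDerivAt_id t).mul (hasDerivAt_integral_of_continuous hz t)).sub
    (hasDerivAt_integral_of_continuous (f := fun s => s * z s) (by fun_prop) t)) ?_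
  simp

lemma continuous_integral_sub_mul {z : ℝ → ℝ} (hz : Continuous z) :
    Continuous fun t => ∫ s in (0:ℝ)..t, (t - s) * z s :=
  continuous_iff_continuousAt.2 fun t => (hasDerivAt_integral_sub_mul hz t).continuousAt

lemma hasDerivAt_integral_sub_sq_mul {z : ℝ → ℝ} (hz : Continuous z) (t : ℝ) :
    HasDerivAt (fun x => ∫ s in (0:ℝ)..x, (x - s) ^ 2 * z s)
      (2 * ∫ s in (0:ℝ)..t, (t - s) * z s) t := by
  have hsplit : (fun x => ∫ s in (0:ℝ)..x, (x - s) ^ 2 * z s) =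
      fun x => x * (∫ s in (0:ℝ)..x, (x - s) * z s) -
        ∫ s in (0:ℝ)..x, (x - s) * (s * z s) := by
    funext x
    rw [← intervalIntegral.integral_const_mul, ← intervalIntegral.integral_sub
      (Continuous.intervalIntegrable (by fun_prop) _ _)
      (Continuous.intervalIntegrable (by fun_prop) _ _)]
    congr 1
    funext s
    ring
  rw [hsplit]
  refine HasDerivAt.congr_deriv (((hasDerivAt_id t).mul (hasDerivAt_integral_sub_mul hz t)).sub
    (hasDerivAt_integral_sub_mul (z := fun s => s * z s) (by fun_prop) t)) ?_
  simp only [id, integral_sub_mul hz]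
  ring

lemma integral_integral_sub_mul {z : ℝ → ℝ} (hz : Continuous z) (b : ℝ) :
    ∫ t in (0:ℝ)..b, (∫ s in (0:ℝ)..t, (t - s) * z s) =
      (∫ s in (0:ℝ)..b, (b - s) ^ 2 * z s) / 2 := by
  have h := intervalIntegral.integral_eq_sub_of_hasDerivAt
    (fun t _ => hasDerivAt_integral_sub_sq_mul hz t)
    (((continuous_integral_sub_mul hz).const_mul 2).intervalIntegrable 0 b)
  rw [intervalIntegral.integral_const_mul, intervalIntegral.integral_same] at h
  linarith

theorem stmt_0 (T η α : ℝ) (hη0 : 0 < η) (hηT : η < T) (hαη : α * η ≠ 1)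
    (y : ℝ → ℝ) (hy : ContinuousOn y (Icc 0 T))
    (u : ℝ → ℝ)
    (hu : ∀ t, u t =
      (1 / (1 - α * η)) * (∫ s in (0:ℝ)..T, (T - s) * y s)
        - (α / (2 * (1 - α * η))) * (∫ s in (0:ℝ)..η, (η - s) ^ 2 * y s)
        - ∫ s in (0:ℝ)..t, (t - s) * y s) :
    IsLinBVPSol T η α y u := by
  have hT : (0:ℝ) ≤ T := (hη0.trans hηT).le
  obtain ⟨z, hz, hzy⟩ : ∃ z : ℝ → ℝ, Continuous z ∧ EqOn z y (Icc 0 T) :=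
    ⟨IccExtend hT ((Icc 0 T).domRestrict y), hy.domRestrict.Icc_extend',
      fun t ht => IccExtend_of_mem hT _ ht⟩
  have hcongr (k : ℝ → ℝ) {t : ℝ} (ht : t ∈ Icc 0 T) :
      ∫ s in (0:ℝ)..t, k s * y s = ∫ s in (0:ℝ)..t, k s * z s := by
    refine intervalIntegral.integral_congr fun s hs => ?_
    rw [uIcc_of_le ht.1] at hs
    simp only [hzy ⟨hs.1, hs.2.trans ht.2⟩]
  have hηmem : η ∈ Icc 0 T := ⟨hη0.le, hηT.le⟩
  have hTmem : T ∈ Icc 0 T := right_mem_Icc.2 hT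
  set c := 1 / (1 - α * η) * (∫ s in (0:ℝ)..T, (T - s) * y s)
    - α / (2 * (1 - α * η)) * (∫ s in (0:ℝ)..η, (η - s) ^ 2 * y s) with hc
  have huz : EqOn u (fun t => c - ∫ s in (0:ℝ)..t, (t - s) * z s) (Icc 0 T) := fun t ht => by
    rw [hu t, hcongr _ ht]
  refine ⟨fun t => -∫ s in (0:ℝ)..t, z s, fun t => -z t, fun t ht => ?_, fun t _ => ?_,
    fun t ht => ?_, by simp, ?_⟩
  · exact ((hasDerivAt_integral_sub_mul hz t).const_sub c).hasDerivWithinAt.congr huz (huz ht)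
  · exact (hasDerivAt_integral_of_continuous hz t).neg.hasDerivWithinAt
  · simp [hzy (Ioo_subset_Icc_self ht)]
  · have hint : ∫ s in (0:ℝ)..η, u s =
        η * c - (∫ s in (0:ℝ)..η, (η - s) ^ 2 * z s) / 2 := by
      rw [← integral_integral_sub_mul hz, intervalIntegral.integral_congr (huz.mono _),
        intervalIntegral.integral_sub intervalIntegrable_const ((continuous_integral_sub_mul hz).intervalIntegrable _ _)]
      · simp
      · rw [uIcc_of_le hη0.le]
        exact Icc_subset_Icc_right hηT.le
    have hne : 1 - α * η ≠ 0 := sub_ne_zero.2 hαη.symm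
    rw [hcongr _ hTmem, hcongr _ hηmem] at hc
    have hmul : c * (1 - α * η) = (∫ s in (0:ℝ)..T, (T - s) * z s)
        - α / 2 * ∫ s in (0:ℝ)..η, (η - s) ^ 2 * z s := by
      rw [hc]
      field_simp
    rw [hint, huz hTmem]
    linear_combination hmul
end
end

section
/- Let T, η, α be real constants with 0 < η < T and αη ≠ 1, and let y : [0,T] → ℝ be continuous. If u : [0,T] → ℝ is any solution of the linear BVP, then for every t ∈ [0,T], u(t) = (1/(1−αη))∫₀^T (T−s)y(s) ds − (α/(2(1−αη)))∫₀^η (η−s)² y(s) ds − ∫₀^t (t−s)y(s) ds; in particular the solution of the linear BVP is unique. -/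
open Set MeasureTheory Filter

noncomputable section

namespace IsLinBVPSol

variable {T η α : ℝ} {y u : ℝ → ℝ}

/-- Taylor's formula with integral remainder for a solution. -/
theorem eq_sub_integral {u' u'' : ℝ → ℝ}
    (hy : ContinuousOn y (Icc 0 T))
    (hu : ∀ t ∈ Icc (0:ℝ) T, HasDerivWithinAt u (u' t) (Icc (0:ℝ) T) t)
    (hu' : ∀ t ∈ Icc (0:ℝ) T, HasDerivWithinAt u' (u'' t) (Icc (0:ℝ) T) t)
    (heq : ∀ t ∈ Ioo (0:ℝ) T, u'' t + y t = 0) (h0 : u' 0 = 0)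
    {t : ℝ} (ht : t ∈ Icc (0:ℝ) T) :
    u t = u 0 - ∫ s in (0:ℝ)..t, (t - s) * y s := by
  have hsub : Icc 0 t ⊆ Icc 0 T := Icc_subset_Icc_right ht.2
  have huc : ContinuousOn u (Icc 0 t) := fun s hs => (hu s (hsub hs)).continuousWithinAt.mono hsub
  have huc' : ContinuousOn u' (Icc 0 t) :=
    fun s hs => (hu' s (hsub hs)).continuousWithinAt.mono hsub
  have hyc : ContinuousOn y (Icc 0 t) := hy.mono hsub
  have key := intervalIntegral.integral_eq_sub_of_hasDerivAt_of_le ht.1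
    (f := fun s => (t - s) * u' s + u s) (f' := fun s => -((t - s) * y s))
    (by fun_prop)
    (fun s hs => by
      have hs' : s ∈ Ioo 0 T := ⟨hs.1, hs.2.trans_le ht.2⟩
      have hnhds := Icc_mem_nhds hs'.1 hs'.2
      have hd := (hu s (Ioo_subset_Icc_self hs')).hasDerivAt hnhds
      have hd' := (hu' s (Ioo_subset_Icc_self hs')).hasDerivAt hnhds
      refine ((((hasDerivAt_id s).const_sub t).mul hd').add hd).congr_deriv ?_
      simp only [id_eq]
      linear_combination (t - s) * heq s hs')
    (ContinuousOn.intervalIntegrable_of_Icc ht.1 (by fun_prop))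
  rw [intervalIntegral.integral_neg] at key
  simp only [h0] at key
  linarith

theorem integral_eq {u' u'' : ℝ → ℝ}
    (hy : ContinuousOn y (Icc 0 T))
    (hu : ∀ t ∈ Icc (0:ℝ) T, HasDerivWithinAt u (u' t) (Icc (0:ℝ) T) t)
    (hu' : ∀ t ∈ Icc (0:ℝ) T, HasDerivWithinAt u' (u'' t) (Icc (0:ℝ) T) t)
    (heq : ∀ t ∈ Ioo (0:ℝ) T, u'' t + y t = 0) (h0 : u' 0 = 0)
    {t : ℝ} (ht : t ∈ Icc (0:ℝ) T) :
    ∫ s in (0:ℝ)..t, u s = t * u 0 - 1 / 2 * ∫ s in (0:ℝ)..t, (t - s) ^ 2 * y s := by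
  have hsub : Icc 0 t ⊆ Icc 0 T := Icc_subset_Icc_right ht.2
  have huc : ContinuousOn u (Icc 0 t) := fun s hs => (hu s (hsub hs)).continuousWithinAt.mono hsub
  have huc' : ContinuousOn u' (Icc 0 t) :=
    fun s hs => (hu' s (hsub hs)).continuousWithinAt.mono hsub
  have hyc : ContinuousOn y (Icc 0 t) := hy.mono hsub
  have hui : IntervalIntegrable u volume 0 t := huc.intervalIntegrable_of_Icc ht.1
  have hyi : IntervalIntegrable (fun s => 1 / 2 * ((t - s) ^ 2 * y s)) volume 0 t :=
    ContinuousOn.intervalIntegrable_of_Icc ht.1 (by fun_prop)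
  have key := intervalIntegral.integral_eq_sub_of_hasDerivAt_of_le ht.1
    (f := fun s => -((t - s) * u s) - 1 / 2 * ((t - s) ^ 2 * u' s))
    (f' := fun s => u s + 1 / 2 * ((t - s) ^ 2 * y s))
    (by fun_prop)
    (fun s hs => by
      have hs' : s ∈ Ioo 0 T := ⟨hs.1, hs.2.trans_le ht.2⟩
      have hnhds := Icc_mem_nhds hs'.1 hs'.2
      have hd := (hu s (Ioo_subset_Icc_self hs')).hasDerivAt hnhds
      have hd' := (hu' s (Ioo_subset_Icc_self hs')).hasDerivAt hnhds
      have hl := (hasDerivAt_id s).const_sub t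
      refine ((hl.mul hd).neg.sub (((hl.pow 2).mul hd').const_mul (1 / 2))).congr_deriv ?_
      simp only [id_eq, Pi.pow_apply]
      push_cast
      linear_combination -(1 / 2) * (t - s) ^ 2 * heq s hs')
    (hui.add hyi)
  rw [intervalIntegral.integral_add hui hyi, intervalIntegral.integral_const_mul] at key
  simp only [h0] at key
  linarith

theorem eq_formula (hη0 : 0 < η) (hηT : η < T) (hαη : α * η ≠ 1)
    (hy : ContinuousOn y (Icc 0 T)) (hu : IsLinBVPSol T η α y u)
    {t : ℝ} (ht : t ∈ Icc (0:ℝ) T) :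
    u t =
      (1 / (1 - α * η)) * (∫ s in (0:ℝ)..T, (T - s) * y s)
        - (α / (2 * (1 - α * η))) * (∫ s in (0:ℝ)..η, (η - s) ^ 2 * y s)
        - ∫ s in (0:ℝ)..t, (t - s) * y s := by
  obtain ⟨u', u'', hd, hd', heq, h0, hT⟩ := hu
  have hne : 1 - α * η ≠ 0 := sub_ne_zero.mpr hαη.symm
  rw [eq_sub_integral hy hd hd' heq h0 (right_mem_Icc.mpr (hη0.trans hηT).le),
    integral_eq hy hd hd' heq h0 ⟨hη0.le, hηT.le⟩] at hT
  rw [eq_sub_integral hy hd hd' heq h0 ht]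
  congr 1
  field_simp
  linear_combination 2 * hT

end IsLinBVPSol

theorem stmt_1 (T η α : ℝ) (hη0 : 0 < η) (hηT : η < T) (hαη : α * η ≠ 1)
    (y : ℝ → ℝ) (hy : ContinuousOn y (Icc 0 T))
    (u : ℝ → ℝ) (hu : IsLinBVPSol T η α y u) :
    (∀ t ∈ Icc (0:ℝ) T, u t =
      (1 / (1 - α * η)) * (∫ s in (0:ℝ)..T, (T - s) * y s)
        - (α / (2 * (1 - α * η))) * (∫ s in (0:ℝ)..η, (η - s) ^ 2 * y s)
        - ∫ s in (0:ℝ)..t, (t - s) * y s) ∧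
    (∀ v : ℝ → ℝ, IsLinBVPSol T η α y v → ∀ t ∈ Icc (0:ℝ) T, v t = u t) := by
  refine ⟨fun t ht => hu.eq_formula hη0 hηT hαη hy ht, fun v hv t ht => ?_⟩
  rw [hv.eq_formula hη0 hηT hαη hy ht, hu.eq_formula hη0 hηT hαη hy ht]
end
end

section
/- Let T, η, α be real constants with 0 < η < T and 0 < α < 1/η, and let y : [0,T] → [0,∞) be continuous. If u : [0,T] → ℝ is a solution of the linear BVP, then u(t) ≥ 0 for all t ∈ [0,T]. -/
open Set MeasureTheory Filter

noncomputable section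

/-- A solution of the linear BVP with nonnegative forcing term is nonincreasing on `[0,T]`. -/
theorem IsLinBVPSol.antitoneOn {T η α : ℝ} {y u : ℝ → ℝ} (hu : IsLinBVPSol T η α y u)
    (hy0 : ∀ t ∈ Icc (0:ℝ) T, 0 ≤ y t) : AntitoneOn u (Icc 0 T) := by
  obtain ⟨u', u'', h1, h2, h3, h4, -⟩ := hu
  have hu' : AntitoneOn u' (Icc 0 T) := by
    refine antitoneOn_of_hasDerivWithinAt_nonpos (convex_Icc 0 T)
      (fun t ht => (h2 t ht).continuousWithinAt)
      (fun t ht => (h2 t (interior_subset ht)).mono interior_subset) fun t ht => ?_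
    rw [interior_Icc] at ht
    linarith [h3 t ht, hy0 t (Ioo_subset_Icc_self ht)]
  refine antitoneOn_of_hasDerivWithinAt_nonpos (convex_Icc 0 T)
    (fun t ht => (h1 t ht).continuousWithinAt)
    (fun t ht => (h1 t (interior_subset ht)).mono interior_subset) fun t ht => ?_
  have ht' := interior_subset ht
  exact h4 ▸ hu' (left_mem_Icc.2 (ht'.1.trans ht'.2)) ht' ht'.1

theorem stmt_2 (T η α : ℝ) (hη0 : 0 < η) (hηT : η < T)
    (hα0 : 0 < α) (hα1 : α < 1 / η)
    (y : ℝ → ℝ) (hy : ContinuousOn y (Icc 0 T)) (hy0 : ∀ t ∈ Icc (0:ℝ) T, 0 ≤ y t)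
    (u : ℝ → ℝ) (hu : IsLinBVPSol T η α y u) :
    ∀ t ∈ Icc (0:ℝ) T, 0 ≤ u t := by
  have hanti := hu.antitoneOn hy0
  obtain ⟨_, _, _, _, _, _, hT⟩ := hu
  have hTmem : T ∈ Icc (0:ℝ) T := right_mem_Icc.2 (hη0.trans hηT).le
  have hsub : Icc (0:ℝ) η ⊆ Icc 0 T := Icc_subset_Icc_right hηT.le
  have hint : IntervalIntegrable u volume 0 η := by
    apply AntitoneOn.intervalIntegrable
    rw [uIcc_of_le hη0.le]
    exact hanti.mono hsub
  have hle : η * u T ≤ ∫ s in (0:ℝ)..η, u s := by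
    have := intervalIntegral.integral_mono_on hη0.le
      (intervalIntegrable_const (c := u T)) hint
      fun s hs => hanti (hsub hs) hTmem (hsub hs).2
    simpa using this
  have hαη : α * η < 1 := (lt_div_iff₀ hη0).1 hα1
  have hTnonneg : 0 ≤ u T := by
    have := mul_le_mul_of_nonneg_left hle hα0.le
    by_contra! hneg
    nlinarith
  exact fun t ht => hTnonneg.trans (hanti ht hTmem ht.2)
end
end

section
/- Let T, η, α be real constants with 0 < η < T and α > 1/η, and let y : [0,T] → [0,∞) be continuous. If u : [0,T] → ℝ is a solution of the linear BVP with u(t) ≥ 0 for all t ∈ [0,T], then u(t) = 0 for all t ∈ [0,T]; that is, the linear BVP has no nontrivial nonnegative solution. -/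
open Set MeasureTheory Filter

noncomputable section

theorem stmt_3 (T η α : ℝ) (hη0 : 0 < η) (hηT : η < T)
    (hα : 1 / η < α)
    (y : ℝ → ℝ) (hy : ContinuousOn y (Icc 0 T)) (hy0 : ∀ t ∈ Icc (0:ℝ) T, 0 ≤ y t)
    (u : ℝ → ℝ) (hu : IsLinBVPSol T η α y u)
    (hupos : ∀ t ∈ Icc (0:ℝ) T, 0 ≤ u t) :
    ∀ t ∈ Icc (0:ℝ) T, u t = 0 := by
  obtain ⟨u', u'', hu1, hu2, hode, hu0, hbc⟩ := hu
  have hT : 0 < T := hη0.trans hηT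
  have hcont : ContinuousOn u (Icc 0 T) := fun t ht => (hu1 t ht).continuousWithinAt
  have hderiv : ∀ t ∈ Ioo (0:ℝ) T, HasDerivAt u (u' t) t := fun t ht =>
    (hu1 t (Ioo_subset_Icc_self ht)).hasDerivAt (Icc_mem_nhds ht.1 ht.2)
  have hanti' : AntitoneOn u' (Icc 0 T) := by
    refine antitoneOn_of_hasDerivWithinAt_nonpos (f' := u'') (convex_Icc 0 T)
      (fun t ht => (hu2 t ht).continuousWithinAt)
      (fun t ht => (hu2 t (interior_subset ht)).mono interior_subset) fun t ht => ?_
    rw [interior_Icc] at ht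
    linarith [hode t ht, hy0 t (Ioo_subset_Icc_self ht)]
  have hanti : AntitoneOn u (Icc 0 T) := by
    refine antitoneOn_of_hasDerivWithinAt_nonpos (f' := u') (convex_Icc 0 T) hcont
      (fun t ht => (hu1 t (interior_subset ht)).mono interior_subset) fun t ht => ?_
    have ht' := interior_subset ht
    exact hu0 ▸ hanti' (left_mem_Icc.2 hT.le) ht' ht'.1
  have hconc : ConcaveOn ℝ (Icc 0 T) u := by
    refine AntitoneOn.concaveOn_of_deriv (convex_Icc 0 T) hcont ?_ ?_
    · rw [interior_Icc]
      exact fun t ht => (hderiv t ht).differentiableAt.differentiableWithinAt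
    · rw [interior_Icc]
      intro a ha b hb hab
      rw [(hderiv a ha).deriv, (hderiv b hb).deriv]
      exact hanti' (Ioo_subset_Icc_self ha) (Ioo_subset_Icc_self hb) hab
  have h0mem : (0:ℝ) ∈ Icc 0 T := left_mem_Icc.2 hT.le
  have hTmem : T ∈ Icc 0 T := right_mem_Icc.2 hT.le
  have hηmem : η ∈ Icc 0 T := ⟨hη0.le, hηT.le⟩
  have hint : η * u η ≤ ∫ s in (0:ℝ)..η, u s := by
    have hui : IntervalIntegrable u volume 0 η := by
      refine ContinuousOn.intervalIntegrable ?_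
      rw [uIcc_of_le hη0.le]
      exact hcont.mono (Icc_subset_Icc_right hηT.le)
    have h := intervalIntegral.integral_mono_on (f := fun _ => u η) hη0.le
      intervalIntegrable_const hui fun s hs => hanti ⟨hs.1, hs.2.trans hηT.le⟩ hηmem hs.2
    simpa using h
  have hα0 : 0 < α := (one_div_pos.2 hη0).trans hα
  have hαη : 1 < α * η := (div_lt_iff₀ hη0).1 hα
  have huT : u T ≤ u η := hanti hηmem hTmem hηT.le
  have huη : u η = 0 := by
    have h := mul_le_mul_of_nonneg_left hint hα0.le
    rw [← hbc] at h
    nlinarith [hupos η hηmem]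
  have hu0_nonpos : u 0 ≤ 0 := by
    have h := hconc.2 h0mem hTmem (sub_nonneg.2 ((div_le_one hT).2 hηT.le))
      (div_nonneg hη0.le hT.le) (sub_add_cancel 1 (η / T))
    have hcomb : (1 - η / T) * 0 + η / T * T = η := by field_simp; ring
    simp only [smul_eq_mul, hcomb, huη] at h
    have hw : 0 < 1 - η / T := sub_pos.2 ((div_lt_one hT).2 hηT)
    have hrest : 0 ≤ η / T * u T := mul_nonneg (by positivity) (hupos T hTmem)
    exact nonpos_of_mul_nonpos_right (by linarith) hw
  exact fun t ht => le_antisymm ((hanti h0mem ht ht.1).trans hu0_nonpos) (hupos t ht)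
end
end

section
/- Let T, η, α be real constants with 0 < η < T and 0 < α < 1/η, and let y : [0,T] → [0,∞) be continuous. If u : [0,T] → ℝ is a solution of the linear BVP, then min_{t∈[0,T]} u(t) ≥ γ · max_{t∈[0,T]} |u(t)|, where γ = αη(T−η)/(T−αη²). -/
open Set MeasureTheory Filter

noncomputable section

/-- A function on an interval is antitone if its derivative is nonpositive in the interior. -/
lemma antitoneOn_Icc_of_hasDerivWithinAt_nonpos {f f' : ℝ → ℝ} {a b : ℝ}
    (hf : ∀ t ∈ Icc a b, HasDerivWithinAt f (f' t) (Icc a b) t)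
    (hf' : ∀ t ∈ Ioo a b, f' t ≤ 0) : AntitoneOn f (Icc a b) := by
  refine antitoneOn_of_hasDerivWithinAt_nonpos (f' := f') (convex_Icc a b)
    (fun t ht => (hf t ht).continuousWithinAt) (fun t ht => ?_) (fun t ht => ?_)
  · exact (hf t (interior_subset ht)).mono interior_subset
  · exact hf' t (by rwa [interior_Icc] at ht)

/-- A function on an interval is concave if it has an antitone derivative. -/
lemma concaveOn_Icc_of_hasDerivWithinAt_antitoneOn {f f' : ℝ → ℝ} {a b : ℝ}
    (hf : ∀ t ∈ Icc a b, HasDerivWithinAt f (f' t) (Icc a b) t)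
    (hf' : AntitoneOn f' (Icc a b)) : ConcaveOn ℝ (Icc a b) f := by
  have hderiv : ∀ t ∈ interior (Icc a b), HasDerivAt f (f' t) t := fun t ht =>
    (hf t (interior_subset ht)).hasDerivAt (mem_interior_iff_mem_nhds.1 ht)
  refine AntitoneOn.concaveOn_of_deriv (convex_Icc a b)
    (fun t ht => (hf t ht).continuousWithinAt)
    (fun t ht => (hderiv t ht).differentiableAt.differentiableWithinAt) ?_
  intro s hs t ht hst
  rw [(hderiv s hs).deriv, (hderiv t ht).deriv]
  exact hf' (interior_subset hs) (interior_subset ht) hst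

theorem stmt_4 (T η α : ℝ) (hη0 : 0 < η) (hηT : η < T)
    (hα0 : 0 < α) (hα1 : α < 1 / η)
    (y : ℝ → ℝ) (hy : ContinuousOn y (Icc 0 T)) (hy0 : ∀ t ∈ Icc (0:ℝ) T, 0 ≤ y t)
    (u : ℝ → ℝ) (hu : IsLinBVPSol T η α y u) :
    ∀ t ∈ Icc (0:ℝ) T,
      (α * η * (T - η) / (T - α * η ^ 2)) * sSup ((fun s => |u s|) '' Icc (0:ℝ) T)
        ≤ u t := by
  obtain ⟨u', u'', hu', hu'', hode, hu'0, hbc⟩ := hu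
  have hT : 0 < T := hη0.trans hηT
  have h0mem : (0 : ℝ) ∈ Icc 0 T := ⟨le_rfl, hT.le⟩
  have hTmem : T ∈ Icc 0 T := ⟨hT.le, le_rfl⟩
  have hηmem : η ∈ Icc 0 T := ⟨hη0.le, hηT.le⟩
  have hu'_anti : AntitoneOn u' (Icc 0 T) :=
    antitoneOn_Icc_of_hasDerivWithinAt_nonpos hu'' fun t ht => by
      linarith [hode t ht, hy0 t (Ioo_subset_Icc_self ht)]
  have hu_anti : AntitoneOn u (Icc 0 T) :=
    antitoneOn_Icc_of_hasDerivWithinAt_nonpos hu' fun t ht =>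
      hu'0 ▸ hu'_anti h0mem (Ioo_subset_Icc_self ht) ht.1.le
  have hu_concave := concaveOn_Icc_of_hasDerivWithinAt_antitoneOn hu' hu'_anti
  have hαη : α * η < 1 := (lt_div_iff₀ hη0).1 hα1
  have hden : 0 < T - α * η ^ 2 := by nlinarith
  have hchord : (T - η) * u 0 + η * u T ≤ T * u η := by
    have h := hu_concave.2 h0mem hTmem
      (show 0 ≤ (T - η) / T from div_nonneg (by linarith) hT.le)
      (show 0 ≤ η / T from div_nonneg hη0.le hT.le) (by field_simp; ring)
    have hpt : (T - η) / T * 0 + η / T * T = η := by field_simp; ring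
    simp only [smul_eq_mul, hpt] at h
    calc (T - η) * u 0 + η * u T = T * ((T - η) / T * u 0 + η / T * u T) := by field_simp
      _ ≤ T * u η := mul_le_mul_of_nonneg_left h hT.le
  have hint : η * u η ≤ ∫ s in (0:ℝ)..η, u s := by
    have hcont : ContinuousOn u (uIcc 0 η) := fun t ht => by
      rw [uIcc_of_le hη0.le] at ht ⊢
      have hsub : Icc 0 η ⊆ Icc 0 T := Icc_subset_Icc_right hηT.le
      exact (hu' t (hsub ht)).continuousWithinAt.mono hsub
    have h := intervalIntegral.integral_mono_on hη0.le
      (intervalIntegrable_const (c := u η) (μ := volume)) hcont.intervalIntegrable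
      fun t ht => hu_anti ⟨ht.1, ht.2.trans hηT.le⟩ hηmem ht.2
    simpa using h
  have huT : α * η * (T - η) / (T - α * η ^ 2) * u 0 ≤ u T := by
    have h1 : α * (η * u η) ≤ u T := hbc ▸ mul_le_mul_of_nonneg_left hint hα0.le
    have h2 := mul_le_mul_of_nonneg_left hchord (mul_pos hα0 hη0).le
    have h3 := mul_le_mul_of_nonneg_left h1 hT.le
    rw [div_mul_eq_mul_div, div_le_iff₀ hden]
    linarith
  set γ := α * η * (T - η) / (T - α * η ^ 2) with hγ
  have hγ0 : 0 ≤ γ :=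
    div_nonneg (mul_nonneg (mul_pos hα0 hη0).le (by linarith)) hden.le
  have hγ1 : γ < 1 := by
    rw [hγ, div_lt_one hden]
    nlinarith
  have hu0 : 0 ≤ u 0 := by
    have := hu_anti h0mem hTmem hT.le
    by_contra! hneg
    nlinarith
  have hsup : sSup ((fun s => |u s|) '' Icc (0:ℝ) T) ≤ u 0 := by
    refine csSup_le (Nonempty.image _ ⟨0, h0mem⟩) ?_
    rintro _ ⟨s, hs, rfl⟩
    have hs0 := hu_anti h0mem hs hs.1
    have hsT := hu_anti hs hTmem hs.2
    exact abs_le.2 ⟨by linarith [mul_nonneg hγ0 hu0], hs0⟩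
  intro t ht
  exact (mul_le_mul_of_nonneg_left hsup hγ0).trans (huT.trans (hu_anti ht hTmem ht.2))
end
end

section
/- Let T, η, α be real constants with 0 < η < T and 0 < α < 1/η, and let y : [0,T] → [0,∞) be continuous. If u : [0,T] → ℝ is a solution of the linear BVP, then u(T) ≥ (αη/2)(u(0) + u(η)) ≥ αη·u(η). -/
open Set MeasureTheory Filter

noncomputable section

/-- The Hermite-Hadamard lower bound: the integral of a concave function is at least its
trapezoidal approximation. -/
theorem ConcaveOn.trapezoid_le_integral {f : ℝ → ℝ} {a b : ℝ} (hab : a < b)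
    (hf : ConcaveOn ℝ (Icc a b) f) (hfi : IntervalIntegrable f volume a b) :
    (b - a) / 2 * (f a + f b) ≤ ∫ s in a..b, f s := by
  have hba : 0 < b - a := sub_pos.2 hab
  have hchord : ∫ s in a..b, (f a + (f b - f a) / (b - a) * (s - a)) =
      (b - a) / 2 * (f a + f b) := by
    rw [intervalIntegral.integral_add (by simp)
      (Continuous.intervalIntegrable (by fun_prop) _ _), intervalIntegral.integral_const_mul,
      intervalIntegral.integral_sub (by simp) (by simp), integral_id]
    simp only [intervalIntegral.integral_const, smul_eq_mul]
    field_simp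
    ring
  rw [← hchord]
  refine intervalIntegral.integral_mono_on hab.le
    (Continuous.intervalIntegrable (by fun_prop) _ _) hfi fun s hs => ?_
  have h := hf.2 (left_mem_Icc.2 hab.le) (right_mem_Icc.2 hab.le)
    (div_nonneg (sub_nonneg.2 hs.2) hba.le) (div_nonneg (sub_nonneg.2 hs.1) hba.le)
    (by field_simp; ring)
  simp only [smul_eq_mul] at h
  have hs' : (b - s) / (b - a) * a + (s - a) / (b - a) * b = s := by
    field_simp
    ring
  rw [hs'] at h
  refine le_of_eq_of_le ?_ h
  field_simp
  ring

theorem stmt_7 (T η α : ℝ) (hη0 : 0 < η) (hηT : η < T)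
    (hα0 : 0 < α) (hα1 : α < 1 / η)
    (y : ℝ → ℝ) (hy : ContinuousOn y (Icc 0 T)) (hy0 : ∀ t ∈ Icc (0:ℝ) T, 0 ≤ y t)
    (u : ℝ → ℝ) (hu : IsLinBVPSol T η α y u) :
    α * η / 2 * (u 0 + u η) ≤ u T ∧ α * η * u η ≤ α * η / 2 * (u 0 + u η) := by
  obtain ⟨u', u'', hu', hu'', heq, hu'0, huT⟩ := hu
  have hT : 0 < T := hη0.trans hηT
  have hcont : ContinuousOn u (Icc 0 T) := fun t ht => (hu' t ht).continuousWithinAt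
  have hderiv : ∀ t ∈ interior (Icc (0:ℝ) T),
      HasDerivWithinAt u (u' t) (interior (Icc (0:ℝ) T)) t := fun t ht =>
    (hu' t (interior_subset ht)).mono interior_subset
  have hderiv2 : ∀ t ∈ interior (Icc (0:ℝ) T),
      HasDerivWithinAt u' (u'' t) (interior (Icc (0:ℝ) T)) t := fun t ht =>
    (hu'' t (interior_subset ht)).mono interior_subset
  have hu''_nonpos : ∀ t ∈ interior (Icc (0:ℝ) T), u'' t ≤ 0 := fun t ht => by
    have hyt := hy0 t (interior_subset ht)
    rw [interior_Icc] at ht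
    linarith [heq t ht]
  have hu'_anti : AntitoneOn u' (Icc 0 T) :=
    antitoneOn_of_hasDerivWithinAt_nonpos (convex_Icc 0 T)
      (fun t ht => (hu'' t ht).continuousWithinAt) hderiv2 hu''_nonpos
  have hu_anti : AntitoneOn u (Icc 0 T) :=
    antitoneOn_of_hasDerivWithinAt_nonpos (convex_Icc 0 T) hcont hderiv fun t ht =>
      (hu'_anti (left_mem_Icc.2 hT.le) (interior_subset ht) (interior_subset ht).1).trans_eq hu'0
  have hsub : Icc 0 η ⊆ Icc 0 T := Icc_subset_Icc_right hηT.le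
  have hconc : ConcaveOn ℝ (Icc 0 η) u :=
    (concaveOn_of_hasDerivWithinAt2_nonpos (convex_Icc 0 T) hcont hderiv hderiv2
      hu''_nonpos).subset hsub (convex_Icc 0 η)
  have hint := hconc.trapezoid_le_integral hη0
    ((hcont.mono hsub).intervalIntegrable_of_Icc hη0.le)
  have hle : u η ≤ u 0 := hu_anti (left_mem_Icc.2 hT.le) ⟨hη0.le, hηT.le⟩ hη0.le
  constructor
  · rw [huT]
    calc α * η / 2 * (u 0 + u η) = α * ((η - 0) / 2 * (u 0 + u η)) := by ring
      _ ≤ α * ∫ s in (0:ℝ)..η, u s := mul_le_mul_of_nonneg_left hint hα0.le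
  · have hαη : 0 ≤ α * η := (mul_pos hα0 hη0).le
    nlinarith [mul_le_mul_of_nonneg_left hle hαη]
end
end

section
/- Let T, η, α be real constants with 0 < η < T and αη ≠ 1, and let y : [0,T] → ℝ be continuous. If u : [0,T] → ℝ is the solution of the linear BVP, then its value at η satisfies u(η) = (1/(2(1−αη))) ∫₀^η [2(T−η) + α(η²−s²)] y(s) ds + (1/(1−αη)) ∫_η^T (T−s) y(s) ds. -/
open Set MeasureTheory Filter

noncomputable section

theorem stmt_8 (T η α : ℝ) (hη0 : 0 < η) (hηT : η < T) (hαη : α * η ≠ 1)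
    (y : ℝ → ℝ) (hy : ContinuousOn y (Icc 0 T))
    (u : ℝ → ℝ) (hu : IsLinBVPSol T η α y u) :
    u η = (1 / (2 * (1 - α * η))) *
        (∫ s in (0:ℝ)..η, (2 * (T - η) + α * (η ^ 2 - s ^ 2)) * y s)
      + (1 / (1 - α * η)) * ∫ s in η..T, (T - s) * y s := by
  obtain ⟨u', u'', hu', hu'', hode, hu'0, hbc⟩ := hu
  have hcu : ContinuousOn u (Icc 0 T) := fun t ht => (hu' t ht).continuousWithinAt
  have hcu' : ContinuousOn u' (Icc 0 T) := fun t ht => (hu'' t ht).continuousWithinAt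
  have hdu : ∀ t ∈ Ioo 0 T, HasDerivAt u (u' t) t := fun t ht =>
    (hu' t (Ioo_subset_Icc_self ht)).hasDerivAt (Icc_mem_nhds ht.1 ht.2)
  have hdu' : ∀ t ∈ Ioo 0 T, HasDerivAt u' (-y t) t := fun t ht => by
    rw [← eq_neg_of_add_eq_zero_left (hode t ht)]
    exact (hu'' t (Ioo_subset_Icc_self ht)).hasDerivAt (Icc_mem_nhds ht.1 ht.2)
  have hleft : Icc 0 η ⊆ Icc 0 T := Icc_subset_Icc_right hηT.le
  have hright : Icc η T ⊆ Icc 0 T := Icc_subset_Icc_left hη0.le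
  have hIu : IntervalIntegrable u volume 0 η :=
    (hcu.mono hleft).intervalIntegrable_of_Icc hη0.le
  have hIy : IntervalIntegrable (fun s => (2 * (T - η) + α * (η ^ 2 - s ^ 2)) * y s)
      volume 0 η :=
    ContinuousOn.intervalIntegrable_of_Icc hη0.le
      (ContinuousOn.mul (by fun_prop) (hy.mono hleft))
  have h₁ := intervalIntegral.integral_eq_sub_of_hasDerivAt_of_le hη0.le
    (f := fun t => (2 * (T - η) + α * (η ^ 2 - t ^ 2)) * u' t + 2 * α * (t * u t))
    (f' := fun t => 2 * α * u t - (2 * (T - η) + α * (η ^ 2 - t ^ 2)) * y t)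
    ((ContinuousOn.mul (by fun_prop) (hcu'.mono hleft)).add
      (continuousOn_const.mul (continuousOn_id.mul (hcu.mono hleft))))
    (fun t ht => by
      have ht' : t ∈ Ioo 0 T := ⟨ht.1, ht.2.trans hηT⟩
      have hk : HasDerivAt (fun t : ℝ => 2 * (T - η) + α * (η ^ 2 - t ^ 2))
          (α * -(2 * t)) t := by
        simpa using ((((hasDerivAt_pow 2 t).const_sub (η ^ 2)).const_mul α).const_add
          (2 * (T - η)))
      refine ((hk.mul (hdu' t ht')).add
        (((hasDerivAt_id t).mul (hdu t ht')).const_mul (2 * α))).congr_deriv ?_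
      rw [id_eq]
      ring)
    ((hIu.const_mul (2 * α)).sub hIy)
  rw [intervalIntegral.integral_sub (hIu.const_mul (2 * α)) hIy,
    intervalIntegral.integral_const_mul, hu'0] at h₁
  have h₂ := intervalIntegral.integral_eq_sub_of_hasDerivAt_of_le hηT.le
    (f := fun t => -((T - t) * u' t + u t)) (f' := fun t => (T - t) * y t)
    ((ContinuousOn.mul (by fun_prop) (hcu'.mono hright)).add (hcu.mono hright)).neg
    (fun t ht => by
      have ht' : t ∈ Ioo 0 T := ⟨hη0.trans ht.1, ht.2⟩
      refine ((((hasDerivAt_id t).const_sub T).mul (hdu' t ht')).add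
        (hdu t ht')).neg.congr_deriv ?_
      rw [id_eq]
      ring)
    (ContinuousOn.intervalIntegrable_of_Icc hηT.le
      (ContinuousOn.mul (by fun_prop) (hy.mono hright)))
  have hne : 1 - α * η ≠ 0 := sub_ne_zero.mpr hαη.symm
  rw [h₂]
  field_simp
  linear_combination h₁ + 2 * hbc
end
end

section
/- Assume T, η, α are real constants with 0 < η < T and 0 < α < 1/η, f satisfies (B1), a satisfies (B2), and additionally f₀ = 0 and f∞ = ∞ (i.e. f(u)/u → 0 as u → 0⁺ and f(u)/u → ∞ as u → ∞). Then the BVP u''(t) + a(t)f(u(t)) = 0 on (0,T), u'(0) = 0, u(T) = α ∫₀^η u(s) ds has at least one positive solution. -/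
open Set MeasureTheory Filter

noncomputable section

/-- `u` is a solution of the nonlinear BVP
`u''(t) + a(t) f(u(t)) = 0` on `(0,T)`, `u'(0) = 0`, `u(T) = α ∫₀^η u(s) ds`,
where derivatives are taken within `[0,T]`. -/
def IsBVPSol (T η α : ℝ) (f a u : ℝ → ℝ) : Prop :=
  ∃ u' u'' : ℝ → ℝ,
    (∀ t ∈ Icc (0:ℝ) T, HasDerivWithinAt u (u' t) (Icc (0:ℝ) T) t) ∧
    (∀ t ∈ Icc (0:ℝ) T, HasDerivWithinAt u' (u'' t) (Icc (0:ℝ) T) t) ∧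
    (∀ t ∈ Ioo (0:ℝ) T, u'' t + a t * f (u t) = 0) ∧
    u' 0 = 0 ∧
    u T = α * ∫ s in (0:ℝ)..η, u s

/-- `u` is a positive solution of the nonlinear BVP. -/
def IsPosSol (T η α : ℝ) (f a u : ℝ → ℝ) : Prop :=
  (∀ t ∈ Icc (0:ℝ) T, 0 < u t) ∧ IsBVPSol T η α f a u

/-- `‖u‖ = max_{t ∈ [0,T]} |u(t)|`. -/
def supNorm (T : ℝ) (u : ℝ → ℝ) : ℝ :=
  sSup ((fun t => |u t|) '' Icc (0:ℝ) T)

/-- `γ = αη(T−η)/(T−αη²)`. -/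
def gammaBVP (T η α : ℝ) : ℝ := α * η * (T - η) / (T - α * η ^ 2)

/-- `Λ₁ = (1−αη)/∫₀^T (T−s)a(s) ds`. -/
def lambda1 (T η α : ℝ) (a : ℝ → ℝ) : ℝ :=
  (1 - α * η) / ∫ s in (0:ℝ)..T, (T - s) * a s

/-- `Λ₂ = (1−αη)/(γ(∫_η^T (T−s)a(s) ds + (1/2)∫₀^η [2(T−η)+α(η²−s²)] a(s) ds))`. -/
def lambda2 (T η α : ℝ) (a : ℝ → ℝ) : ℝ :=
  (1 - α * η) / (gammaBVP T η α *
    ((∫ s in η..T, (T - s) * a s) +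
      (1 / 2) * ∫ s in (0:ℝ)..η, (2 * (T - η) + α * (η ^ 2 - s ^ 2)) * a s))


/-- `u` and `v` satisfy `u' = v`, `v' = -A F(u)` on `[0,T]` with `v 0 = 0`. -/
structure IsShot (T : ℝ) (A F u v : ℝ → ℝ) : Prop where
  deriv_fst : ∀ t ∈ Icc (0:ℝ) T, HasDerivWithinAt u (v t) (Icc (0:ℝ) T) t
  deriv_snd : ∀ t ∈ Icc (0:ℝ) T, HasDerivWithinAt v (-(A t * F (u t))) (Icc (0:ℝ) T) t
  snd_zero : v 0 = 0

theorem sub_le_mul_of_deriv_le {T p q C : ℝ} {u v : ℝ → ℝ}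
    (h : ∀ t ∈ Icc (0:ℝ) T, HasDerivWithinAt u (v t) (Icc (0:ℝ) T) t)
    (hp : 0 ≤ p) (hpq : p ≤ q) (hq : q ≤ T) (hv : ∀ t ∈ Ioo p q, v t ≤ C) :
    u q - u p ≤ C * (q - p) := by
  have hsub : Icc p q ⊆ Icc 0 T := Icc_subset_Icc hp hq
  have hd : ∀ t ∈ Ioo p q, HasDerivAt u (v t) t := fun t ht =>
    (h t (hsub (Ioo_subset_Icc_self ht))).hasDerivAt
      (Icc_mem_nhds (hp.trans_lt ht.1) (ht.2.trans_le hq))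
  refine (convex_Icc p q).image_sub_le_mul_sub_of_deriv_le
    (fun t ht => ((h t (hsub ht)).mono hsub).continuousWithinAt) ?_ ?_
    p (left_mem_Icc.2 hpq) q (right_mem_Icc.2 hpq) hpq
  · rw [interior_Icc]
    exact fun t ht => (hd t ht).differentiableAt.differentiableWithinAt
  · rw [interior_Icc]
    intro t ht
    rw [(hd t ht).deriv]
    exact hv t ht

theorem mul_le_sub_of_le_deriv {T p q C : ℝ} {u v : ℝ → ℝ}
    (h : ∀ t ∈ Icc (0:ℝ) T, HasDerivWithinAt u (v t) (Icc (0:ℝ) T) t)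
    (hp : 0 ≤ p) (hpq : p ≤ q) (hq : q ≤ T) (hv : ∀ t ∈ Ioo p q, C ≤ v t) :
    C * (q - p) ≤ u q - u p := by
  have := sub_le_mul_of_deriv_le (u := fun t => -u t) (v := fun t => -v t) (C := -C)
    (fun t ht => (h t ht).neg) hp hpq hq (fun t ht => neg_le_neg (hv t ht))
  linarith

namespace IsShot

variable {T : ℝ} {A F u v : ℝ → ℝ}

theorem snd_antitone (h : IsShot T A F u v) (hA : ∀ t, 0 ≤ A t) (hF : ∀ x, 0 ≤ F x) :
    AntitoneOn v (Icc 0 T) := by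
  intro p hp q hq hpq
  have := sub_le_mul_of_deriv_le h.deriv_snd hp.1 hpq hq.2 (C := 0)
    (fun t _ => neg_nonpos.2 (mul_nonneg (hA t) (hF _)))
  linarith

theorem snd_nonpos (h : IsShot T A F u v) (hA : ∀ t, 0 ≤ A t) (hF : ∀ x, 0 ≤ F x)
    {t : ℝ} (ht : t ∈ Icc 0 T) : v t ≤ 0 := by
  have := h.snd_antitone hA hF (left_mem_Icc.2 (ht.1.trans ht.2)) ht ht.1
  rwa [h.snd_zero] at this

theorem fst_antitone (h : IsShot T A F u v) (hA : ∀ t, 0 ≤ A t) (hF : ∀ x, 0 ≤ F x) :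
    AntitoneOn u (Icc 0 T) := by
  intro p hp q hq hpq
  have := sub_le_mul_of_deriv_le h.deriv_fst hp.1 hpq hq.2 (C := 0)
    (fun t ht => h.snd_nonpos hA hF ⟨hp.1.trans ht.1.le, ht.2.le.trans hq.2⟩)
  linarith

theorem continuousOn_fst (h : IsShot T A F u v) : ContinuousOn u (Icc 0 T) :=
  fun t ht => (h.deriv_fst t ht).continuousWithinAt

theorem continuousOn_snd (h : IsShot T A F u v) : ContinuousOn v (Icc 0 T) :=
  fun t ht => (h.deriv_snd t ht).continuousWithinAt

theorem chord_le (h : IsShot T A F u v) (hA : ∀ t, 0 ≤ A t) (hF : ∀ x, 0 ≤ F x)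
    {η : ℝ} (hη : η ∈ Icc 0 T) : (T - η) * u 0 + η * u T ≤ T * u η := by
  have h1 := mul_le_sub_of_le_deriv h.deriv_fst le_rfl hη.1 hη.2 (C := v η)
    (fun t ht => h.snd_antitone hA hF ⟨ht.1.le, ht.2.le.trans hη.2⟩ hη ht.2.le)
  have h2 := sub_le_mul_of_deriv_le h.deriv_fst hη.1 hη.2 le_rfl (C := v η)
    (fun t ht => h.snd_antitone hA hF hη ⟨hη.1.trans ht.1.le, ht.2.le⟩ ht.1.le)
  nlinarith [mul_le_mul_of_nonneg_left h1 (sub_nonneg.2 hη.2),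
    mul_le_mul_of_nonneg_left h2 hη.1]

theorem intervalIntegrable_fst (h : IsShot T A F u v) {p q : ℝ} (hp : p ∈ Icc 0 T)
    (hq : q ∈ Icc 0 T) : IntervalIntegrable u volume p q :=
  (h.continuousOn_fst.mono (uIcc_subset_Icc hp hq)).intervalIntegrable

theorem mul_le_integral (h : IsShot T A F u v) (hA : ∀ t, 0 ≤ A t) (hF : ∀ x, 0 ≤ F x)
    {η : ℝ} (hη : η ∈ Icc 0 T) : η * u η ≤ ∫ s in (0:ℝ)..η, u s := by
  have := intervalIntegral.integral_mono_on (f := fun _ => u η) (g := u) hη.1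
    intervalIntegrable_const
    (h.intervalIntegrable_fst (left_mem_Icc.2 (hη.1.trans hη.2)) hη)
    (fun t ht => h.fst_antitone hA hF ⟨ht.1, ht.2.trans hη.2⟩ hη ht.2)
  simpa using this

theorem integral_le_mul (h : IsShot T A F u v) (hA : ∀ t, 0 ≤ A t) (hF : ∀ x, 0 ≤ F x)
    {η : ℝ} (hη : η ∈ Icc 0 T) : ∫ s in (0:ℝ)..η, u s ≤ η * u 0 := by
  have h0 : (0:ℝ) ∈ Icc 0 T := left_mem_Icc.2 (hη.1.trans hη.2)
  have := intervalIntegral.integral_mono_on (f := u) (g := fun _ => u 0) hη.1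
    (h.intervalIntegrable_fst h0 hη) intervalIntegrable_const
    (fun t ht => h.fst_antitone hA hF h0 ⟨ht.1, ht.2.trans hη.2⟩ ht.1)
  simpa using this

/-- A solution whose end value dominates the nonlocal term is bounded below by a fixed
fraction of its initial value. -/
theorem cone_le (h : IsShot T A F u v) (hA : ∀ t, 0 ≤ A t) (hF : ∀ x, 0 ≤ F x)
    {η α : ℝ} (hη0 : 0 < η) (hηT : η < T) (hα0 : 0 < α) (hα1 : α * η < 1)
    (hbc : α * ∫ s in (0:ℝ)..η, u s ≤ u T) :
    0 ≤ u T ∧ α * η * (1 - η / T) * u 0 ≤ u T := by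
  have hT : 0 < T := hη0.trans hηT
  have hη : η ∈ Icc 0 T := ⟨hη0.le, hηT.le⟩
  have h1 := mul_le_mul_of_nonneg_left (h.mul_le_integral hA hF hη) hα0.le
  have h2 : u T ≤ u η := h.fst_antitone hA hF hη (right_mem_Icc.2 hT.le) hηT.le
  have hnn : 0 ≤ u T := by
    nlinarith [mul_le_mul_of_nonneg_left h2 (mul_pos hα0 hη0).le]
  refine ⟨hnn, ?_⟩
  have h3 := h.chord_le hA hF hη
  have h4 : (1 - η / T) * u 0 ≤ u η := by
    have : (1 - η / T) * u 0 = (T - η) * u 0 / T := by field_simp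
    rw [this, div_le_iff₀ hT]
    nlinarith [mul_nonneg hη0.le hnn]
  calc α * η * (1 - η / T) * u 0 = α * η * ((1 - η / T) * u 0) := by ring
    _ ≤ α * η * u η := by gcongr
    _ ≤ u T := by linarith

theorem neg_mul_le_snd (h : IsShot T A F u v) {M m : ℝ} (hm : 0 ≤ m)
    (hA : ∀ t, 0 ≤ A t) (hAM : ∀ t, A t ≤ M) (hFm : ∀ t ∈ Icc 0 T, F (u t) ≤ m)
    {t : ℝ} (ht : t ∈ Icc 0 T) : -(M * m * T) ≤ v t := by
  have h1 := mul_le_sub_of_le_deriv h.deriv_snd le_rfl ht.1 ht.2 (C := -(M * m)) (fun s hs => by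
    have h2 := hFm s ⟨hs.1.le, hs.2.le.trans ht.2⟩
    have h3 := mul_le_mul_of_nonneg_left h2 (hA s)
    have h4 := mul_le_mul_of_nonneg_right (hAM s) hm
    linarith)
  rw [h.snd_zero] at h1
  have : 0 ≤ M * m := mul_nonneg ((hA 0).trans (hAM 0)) hm
  nlinarith [mul_le_mul_of_nonneg_left ht.2 this]

theorem lt_of_small (h : IsShot T A F u v) (hA : ∀ t, 0 ≤ A t) (hF : ∀ x, 0 ≤ F x)
    {η α M m : ℝ} (hη : η ∈ Icc 0 T) (hα0 : 0 < α) (hm : 0 ≤ m)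
    (hAM : ∀ t, A t ≤ M) (hFm : ∀ x ≤ u 0, F x ≤ m)
    (hsmall : M * m * T * T < (1 - α * η) * u 0) :
    α * ∫ s in (0:ℝ)..η, u s < u T := by
  have hT : 0 ≤ T := hη.1.trans hη.2
  have h1 := mul_le_sub_of_le_deriv h.deriv_fst le_rfl hT le_rfl (C := -(M * m * T))
    (fun t ht => h.neg_mul_le_snd hm hA hAM
      (fun s hs => hFm _ (h.fst_antitone hA hF (left_mem_Icc.2 hT) hs hs.1))
      (Ioo_subset_Icc_self ht))
  have h2 := mul_le_mul_of_nonneg_left (h.integral_le_mul hA hF hη) hα0.le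
  linarith

theorem lt_of_large (h : IsShot T A F u v) (hA : ∀ t, 0 ≤ A t) (hF : ∀ x, 0 ≤ F x)
    {η α ε p q K : ℝ} (hη0 : 0 < η) (hηT : η < T) (hα0 : 0 < α) (hα1 : α * η < 1)
    (hp : 0 ≤ p) (hpq : p ≤ q) (hq : q ≤ T) (hAε : ∀ t ∈ Ioo p q, ε ≤ A t)
    (hK : 0 ≤ K) (hFK : ∀ x, α * η * (1 - η / T) * u 0 ≤ x → x ≤ u 0 → K ≤ F x)
    (hlarge : u 0 < ε * K * (q - p) * (T - q)) :
    u T < α * ∫ s in (0:ℝ)..η, u s := by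
  by_contra! hbc
  have hT : 0 < T := hη0.trans hηT
  obtain ⟨hnn, hcone⟩ := h.cone_le hA hF hη0 hηT hα0 hα1 hbc
  have hle : ∀ t ∈ Icc 0 T, K ≤ F (u t) := fun t ht => hFK _
    (hcone.trans (h.fst_antitone hA hF ht (right_mem_Icc.2 hT.le) ht.2))
    (h.fst_antitone hA hF (left_mem_Icc.2 hT.le) ht ht.1)
  have h1 := sub_le_mul_of_deriv_le h.deriv_snd hp hpq hq (C := -(ε * K)) (fun t ht => by
    have := mul_le_mul (hAε t ht) (hle t ⟨hp.trans ht.1.le, ht.2.le.trans hq⟩) hK (hA t)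
    linarith)
  have hvp := h.snd_nonpos hA hF ⟨hp, hpq.trans hq⟩
  have hqm : q ∈ Icc 0 T := ⟨hp.trans hpq, hq⟩
  have h2 := sub_le_mul_of_deriv_le h.deriv_fst hqm.1 hq le_rfl (C := v q)
    (fun t ht => h.snd_antitone hA hF hqm ⟨hqm.1.trans ht.1.le, ht.2.le⟩ ht.1.le)
  have h3 := h.fst_antitone hA hF (left_mem_Icc.2 hT.le) hqm hqm.1
  have h4 : v q ≤ -(ε * K) * (q - p) := by linarith
  nlinarith [mul_le_mul_of_nonneg_right h4 (sub_nonneg.2 hq)]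

end IsShot

/-- Global shooting for a bounded Lipschitz nonlinearity; the boundary defect depends
continuously on the initial value. -/
theorem exists_isShot_family {T η α M B R : ℝ} {A F : ℝ → ℝ} {K : NNReal}
    (hT : 0 ≤ T) (hη : η ∈ Icc 0 T) (hAc : Continuous A) (hA : ∀ t, 0 ≤ A t)
    (hAM : ∀ t, A t ≤ M) (hFK : LipschitzWith K F) (hF : ∀ x, 0 ≤ F x) (hFB : ∀ x, F x ≤ B)
    (hR : 0 ≤ R) :
    ∃ U V : ℝ → ℝ → ℝ, (∀ c ∈ Icc 0 R, IsShot T A F (U c) (V c) ∧ U c 0 = c) ∧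
      ContinuousOn (fun c => U c T - α * ∫ s in (0:ℝ)..η, U c s) (Icc 0 R) := by
  have hM : 0 ≤ M := (hA 0).trans (hAM 0)
  have hB : 0 ≤ B := (hF 0).trans (hFB 0)
  have hMB : 0 ≤ M * B := mul_nonneg hM hB
  set b : ℝ := M * B * T with hb
  have hb0 : 0 ≤ b := mul_nonneg hMB hT
  let w : ℝ → ℝ × ℝ → ℝ × ℝ := fun t x => (max (-b) (min x.2 b), -(A t * F x.1))
  have hAF : ∀ t x, |A t * F x| ≤ M * B := fun t x => by
    rw [abs_of_nonneg (mul_nonneg (hA t) (hF x))]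
    exact mul_le_mul (hAM t) (hFB x) (hF x) hM
  let L : NNReal := ⟨max b (M * B), le_max_of_le_left hb0⟩
  let r : NNReal := ⟨R, hR⟩
  let T' : NNReal := ⟨T, hT⟩
  let M' : NNReal := ⟨M, hM⟩
  have hPL : IsPicardLindelof w (⟨0, left_mem_Icc.2 hT⟩ : Icc (0:ℝ) T) (0 : ℝ × ℝ)
      (r + L * T') r L (max 1 (M' * K)) := by
    refine ⟨fun t _ => LipschitzWith.lipschitzOnWith ?_, fun x _ => ?_, fun t _ x _ => ?_, ?_⟩
    · refine LipschitzWith.prodMk ?_ ?_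
      · exact (LipschitzWith.prod_snd.min_const b).const_max (-b)
      · refine LipschitzWith.of_dist_le_mul fun x y => ?_
        have h1 := hFK.dist_le_mul x.1 y.1
        have h2 : dist x.1 y.1 ≤ dist x y := le_max_left _ _
        rw [dist_neg_neg, Real.dist_eq, ← mul_sub, abs_mul, abs_of_nonneg (hA t),
          ← Real.dist_eq, NNReal.coe_mul, mul_assoc]
        exact mul_le_mul (hAM t) (h1.trans (mul_le_mul_of_nonneg_left h2 K.2)) dist_nonneg hM
    · exact (continuous_const.prodMk (hAc.mul continuous_const).neg).continuousOn
    · refine max_le ((abs_le.2 ⟨le_max_left _ _, ?_⟩).trans (le_max_left b (M * B))) ?_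
      · exact max_le (by linarith) (min_le_right _ _)
      · rw [norm_neg]
        exact (hAF t x.1).trans (le_max_right _ _)
    · simp only [sub_zero, sub_self, NNReal.coe_add, NNReal.coe_mul, add_sub_cancel_left]
      rw [max_eq_left hT]
      exact le_rfl
  obtain ⟨X, hX, L', hL'⟩ :=
    hPL.exists_forall_mem_closedBall_eq_hasDerivWithinAt_lipschitzOnWith
  have hmem : ∀ c ∈ Icc 0 R, ((c, 0) : ℝ × ℝ) ∈ Metric.closedBall (0 : ℝ × ℝ) r := by
    intro c hc
    rw [mem_closedBall_zero_iff]
    exact max_le (abs_le.2 ⟨by linarith [hc.1, hR], hc.2⟩) (by simp)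
  have hshot : ∀ c ∈ Icc 0 R,
      IsShot T A F (fun t => (X (c, 0) t).1) (fun t => (X (c, 0) t).2) := by
    intro c hc
    obtain ⟨h0, hd⟩ := hX _ (hmem c hc)
    have hd2 : ∀ t ∈ Icc 0 T, HasDerivWithinAt (fun t => (X (c, 0) t).2)
        (-(A t * F (X (c, 0) t).1)) (Icc 0 T) t := fun t ht => (hd t ht).snd
    have hv0 : (X (c, 0) 0).2 = 0 := congrArg Prod.snd h0
    refine ⟨fun t ht => ?_, hd2, hv0⟩
    have hv := (convex_Icc 0 T).norm_image_sub_le_of_norm_hasDerivWithin_le hd2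
      (fun s _ => by rw [norm_neg]; exact hAF s _) (left_mem_Icc.2 hT) ht
    rw [hv0, sub_zero, sub_zero, Real.norm_eq_abs, Real.norm_eq_abs, abs_of_nonneg ht.1] at hv
    have hvb := abs_le.1 (hv.trans (mul_le_mul_of_nonneg_left ht.2 hMB))
    have h1 := (hd t ht).fst
    simp only [w] at h1
    rwa [min_eq_left hvb.2, max_eq_right hvb.1] at h1
  refine ⟨fun c t => (X (c, 0) t).1, fun c t => (X (c, 0) t).2, fun c hc =>
    ⟨hshot c hc, congrArg Prod.fst (hX _ (hmem c hc)).1⟩, ?_⟩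
  have hlip : ∀ t ∈ Icc 0 T, ∀ c ∈ Icc 0 R, ∀ d ∈ Icc 0 R,
      dist (X (c, 0) t).1 (X (d, 0) t).1 ≤ L' * dist c d := by
    intro t ht c hc d hd
    have h1 := (hL' t ht).dist_le_mul _ (hmem c hc) _ (hmem d hd)
    have h2 : dist ((c, 0) : ℝ × ℝ) (d, 0) = dist c d := by simp [Prod.dist_eq]
    rw [h2] at h1
    exact (le_max_left _ _).trans h1
  refine ContinuousOn.sub ?_ (continuousOn_const.mul ?_)
  · exact (LipschitzOnWith.of_dist_le_mul (hlip T (right_mem_Icc.2 hT))).continuousOn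
  · refine (LipschitzOnWith.of_dist_le_mul (K := L' * ⟨η, hη.1⟩) fun c hc d hd => ?_).continuousOn
    rw [Real.dist_eq, ← intervalIntegral.integral_sub
      ((hshot c hc).intervalIntegrable_fst (left_mem_Icc.2 hT) hη)
      ((hshot d hd).intervalIntegrable_fst (left_mem_Icc.2 hT) hη)]
    have := intervalIntegral.norm_integral_le_of_norm_le_const (a := 0) (b := η)
      (f := fun s => (X (c, 0) s).1 - (X (d, 0) s).1) (C := L' * dist c d) (fun s hs => by
        rw [uIoc_of_le hη.1] at hs
        exact hlip s ⟨hs.1.le, hs.2.trans hη.2⟩ c hc d hd)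
    rw [sub_zero, abs_of_nonneg hη.1] at this
    refine this.trans (le_of_eq ?_)
    exact mul_right_comm _ _ _

theorem exists_lipschitz_approx {R δ : ℝ} {f : ℝ → ℝ} (hR : 0 ≤ R) (hδ : 0 < δ)
    (hf : ContinuousOn f (Icc 0 R)) :
    ∃ (K : NNReal) (F : ℝ → ℝ), LipschitzWith K F ∧
      ∀ x, f (projIcc 0 R hR x) ≤ F x ∧ F x ≤ f (projIcc 0 R hR x) + δ := by
  obtain ⟨p, hp⟩ := exists_polynomial_near_of_continuousOn 0 R f hf (δ / 2) (half_pos hδ)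
  obtain ⟨K, hK⟩ := (p.contDiff_aeval (𝕜 := ℝ) 1).contDiffOn.exists_lipschitzOnWith one_ne_zero
    (convex_Icc 0 R) isCompact_Icc
  simp only [Polynomial.coe_aeval_eq_eval] at hK
  refine ⟨K, fun x => p.eval (projIcc 0 R hR x : ℝ) + δ / 2, ?_, fun x => ?_⟩
  · refine LipschitzWith.of_dist_le_mul fun x y => ?_
    rw [dist_add_right]
    refine (hK.dist_le_mul _ (projIcc 0 R hR x).2 _ (projIcc 0 R hR y).2).trans ?_
    have := (LipschitzWith.projIcc hR).dist_le_mul x y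
    rw [NNReal.coe_one, one_mul] at this
    exact mul_le_mul_of_nonneg_left this K.2
  · have := abs_lt.1 (hp _ (projIcc 0 R hR x).2)
    constructor <;> linarith

/-- Pointwise Arzelà–Ascoli for uniformly bounded, uniformly Lipschitz curves on `[0,T]`. -/
theorem exists_subseq_tendsto_of_lipschitz {E : Type*} [MetricSpace E] [ProperSpace E]
    {T : ℝ} (hT : 0 ≤ T) {K : NNReal} {S : Set E} (hS : IsCompact S) (X : ℕ → ℝ → E)
    (hX : ∀ n, LipschitzOnWith K (X n) (Icc 0 T)) (hXS : ∀ n, ∀ t ∈ Icc 0 T, X n t ∈ S) :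
    ∃ (g : ℝ → E) (φ : ℕ → ℕ), Continuous g ∧ StrictMono φ ∧
      ∀ t ∈ Icc 0 T, Tendsto (fun n => X (φ n) t) atTop (nhds (g t)) := by
  let Y : ℕ → BoundedContinuousFunction (Icc (0:ℝ) T) E := fun n =>
    BoundedContinuousFunction.mkOfCompact ⟨(Icc 0 T).domRestrict (X n), (hX n).continuousOn.domRestrict⟩
  have hcomp : IsCompact (closure (range Y)) := by
    refine BoundedContinuousFunction.arzela_ascoli S hS _ ?_ ?_
    · rintro _ x ⟨n, rfl⟩
      exact hXS n x x.2
    · refine (LipschitzWith.uniformEquicontinuous _ K ?_).equicontinuous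
      rintro ⟨_, n, rfl⟩
      exact (hX n).to_restrict
  obtain ⟨G, -, φ, hφ, hlim⟩ := hcomp.tendsto_subseq (x := Y)
    (fun n => subset_closure (mem_range_self n))
  refine ⟨fun t => G (projIcc 0 T hT t), φ, G.continuous.comp continuous_projIcc, hφ, ?_⟩
  intro t ht
  have h := ((BoundedContinuousFunction.lipschitz_eval_const
    (projIcc 0 T hT t)).continuous.tendsto G).comp hlim
  rw [projIcc_of_mem hT ht] at h
  beta_reduce
  rw [projIcc_of_mem hT ht]
  exact h

theorem IsShot.integral_eq {T : ℝ} {A F u v : ℝ → ℝ} (h : IsShot T A F u v)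
    (hA : Continuous A) (hF : Continuous F) {t : ℝ} (ht : t ∈ Icc 0 T) :
    u t = u 0 + (∫ s in (0:ℝ)..t, v s) ∧ v t = -∫ s in (0:ℝ)..t, A s * F (u s) := by
  have hsub : Icc 0 t ⊆ Icc 0 T := Icc_subset_Icc le_rfl ht.2
  have hn : ∀ s ∈ Ioo 0 t, Icc 0 T ∈ nhds s := fun s hs =>
    Icc_mem_nhds hs.1 (hs.2.trans_le ht.2)
  have hu := h.continuousOn_fst.mono hsub
  have hv := h.continuousOn_snd.mono hsub
  have h1 := intervalIntegral.integral_eq_sub_of_hasDerivAt_of_le ht.1 hu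
    (fun s hs => (h.deriv_fst s (hsub (Ioo_subset_Icc_self hs))).hasDerivAt (hn s hs))
    (hv.intervalIntegrable_of_Icc ht.1)
  have h2 := intervalIntegral.integral_eq_sub_of_hasDerivAt_of_le ht.1 hv
    (fun s hs => (h.deriv_snd s (hsub (Ioo_subset_Icc_self hs))).hasDerivAt (hn s hs))
    (((hA.continuousOn.mul (hF.comp_continuousOn hu)).neg).intervalIntegrable_of_Icc ht.1)
  rw [intervalIntegral.integral_neg, h.snd_zero] at h2
  constructor <;> linarith

theorem isShot_of_integral_eq {T : ℝ} {A F u v : ℝ → ℝ} (hA : Continuous A) (hF : Continuous F)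
    (hu : Continuous u) (hv : Continuous v) (hT : 0 ≤ T)
    (h : ∀ t ∈ Icc 0 T, u t = u 0 + (∫ s in (0:ℝ)..t, v s) ∧
      v t = -∫ s in (0:ℝ)..t, A s * F (u s)) : IsShot T A F u v where
  deriv_fst t ht := by
    refine HasDerivWithinAt.congr ?_ (fun s hs => (h s hs).1) (h t ht).1
    exact ((hv.integral_hasStrictDerivAt 0 t).hasDerivAt.const_add _).hasDerivWithinAt
  deriv_snd t ht := by
    refine HasDerivWithinAt.congr ?_ (fun s hs => (h s hs).2) (h t ht).2
    exact ((hA.mul (hF.comp hu)).integral_hasStrictDerivAt 0 t).hasDerivAt.neg.hasDerivWithinAt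
  snd_zero := by simpa using (h 0 (left_mem_Icc.2 hT)).2

theorem tendsto_intervalIntegral_of_bounded {T t C : ℝ} (ht : t ∈ Icc 0 T) {w : ℕ → ℝ → ℝ}
    {g : ℝ → ℝ} (hw : ∀ n, ContinuousOn (w n) (Icc 0 T))
    (hC : ∀ n, ∀ s ∈ Icc 0 T, |w n s| ≤ C)
    (hlim : ∀ s ∈ Icc 0 T, Tendsto (fun n => w n s) atTop (nhds (g s))) :
    Tendsto (fun n => ∫ s in (0:ℝ)..t, w n s) atTop (nhds (∫ s in (0:ℝ)..t, g s)) := by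
  have hsub : uIoc 0 t ⊆ Icc 0 T := by
    rw [uIoc_of_le ht.1]
    exact fun s hs => ⟨hs.1.le, hs.2.trans ht.2⟩
  refine intervalIntegral.tendsto_integral_filter_of_dominated_convergence (fun _ => C)
    (Eventually.of_forall fun n => ?_) (Eventually.of_forall fun n => ?_)
    intervalIntegrable_const ?_
  · exact ((hw n).mono hsub).aestronglyMeasurable measurableSet_uIoc
  · exact Eventually.of_forall fun s hs => hC n s (hsub hs)
  · exact Eventually.of_forall fun s hs => hlim s (hsub hs)

theorem exists_isShot_limit {T η α M B r R : ℝ} {A F₀ : ℝ → ℝ} (hT : 0 ≤ T)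
    (hη : η ∈ Icc 0 T) (hAc : Continuous A) (hA : ∀ t, 0 ≤ A t) (hAM : ∀ t, A t ≤ M)
    (hF₀ : Continuous F₀) {F U V : ℕ → ℝ → ℝ} {δ : ℕ → ℝ} (hδ : Tendsto δ atTop (nhds 0))
    (hFc : ∀ n, Continuous (F n)) (hF : ∀ n x, 0 ≤ F n x) (hFB : ∀ n x, F n x ≤ B)
    (hFδ : ∀ n x, |F n x - F₀ x| ≤ δ n) (hUV : ∀ n, IsShot T A (F n) (U n) (V n))
    (hU0 : ∀ n, U n 0 ∈ Icc r R)
    (hbc : ∀ n, U n T = α * ∫ s in (0:ℝ)..η, U n s) :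
    ∃ u v, IsShot T A F₀ u v ∧ u 0 ∈ Icc r R ∧ u T = α * ∫ s in (0:ℝ)..η, u s := by
  have h0T : (0:ℝ) ∈ Icc 0 T := left_mem_Icc.2 hT
  have hTT : T ∈ Icc 0 T := right_mem_Icc.2 hT
  have hM : 0 ≤ M := (hA 0).trans (hAM 0)
  have hB : 0 ≤ B := (hF 0 0).trans (hFB 0 0)
  have hMB : 0 ≤ M * B := mul_nonneg hM hB
  have hAF : ∀ n t x, |A t * F n x| ≤ M * B := fun n t x => by
    rw [abs_of_nonneg (mul_nonneg (hA t) (hF n x))]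
    exact mul_le_mul (hAM t) (hFB n x) (hF n x) hM
  set b := M * B * T with hb
  have hb0 : 0 ≤ b := mul_nonneg hMB hT
  have hVb : ∀ n, ∀ t ∈ Icc 0 T, |V n t| ≤ b := fun n t ht =>
    abs_le.2 ⟨(hUV n).neg_mul_le_snd hB hA hAM (fun _ _ => hFB n _) ht,
      ((hUV n).snd_nonpos hA (hF n) ht).trans hb0⟩
  set C := |r| + |R| + b * T with hC
  have hUC : ∀ n, ∀ t ∈ Icc 0 T, |U n t| ≤ C := fun n t ht => by
    have h1 := (convex_Icc 0 T).norm_image_sub_le_of_norm_hasDerivWithin_le (hUV n).deriv_fst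
      (hVb n) h0T ht
    rw [sub_zero, Real.norm_eq_abs, Real.norm_eq_abs, abs_of_nonneg ht.1] at h1
    have h2 := h1.trans (mul_le_mul_of_nonneg_left ht.2 hb0)
    have h3 := abs_le.1 h2
    have h4 := hU0 n
    exact abs_le.2 ⟨by linarith [h4.1, neg_abs_le r, abs_nonneg R],
      by linarith [h4.2, le_abs_self R, abs_nonneg r]⟩
  have hS : IsCompact (Icc (-C) C ×ˢ Icc (-b) b : Set (ℝ × ℝ)) := isCompact_Icc.prod isCompact_Icc
  obtain ⟨g, φ, hg, hφ, hlim⟩ := exists_subseq_tendsto_of_lipschitz hT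
    (K := max ⟨b, hb0⟩ ⟨M * B, hMB⟩) hS (fun n t => (U n t, V n t))
    (fun n => by
      refine LipschitzOnWith.prodMk ?_ ?_
      · exact (convex_Icc 0 T).lipschitzOnWith_of_nnnorm_hasDerivWithin_le (hUV n).deriv_fst
          (hVb n)
      · exact (convex_Icc 0 T).lipschitzOnWith_of_nnnorm_hasDerivWithin_le (hUV n).deriv_snd
          (fun t _ => by
            rw [nnnorm_neg]
            exact hAF n t _))
    (fun n t ht => ⟨abs_le.1 (hUC n t ht), abs_le.1 (hVb n t ht)⟩)
  have hu : ∀ t ∈ Icc 0 T, Tendsto (fun n => U (φ n) t) atTop (nhds (g t).1) := fun t ht =>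
    (continuous_fst.tendsto _).comp (hlim t ht)
  have hv : ∀ t ∈ Icc 0 T, Tendsto (fun n => V (φ n) t) atTop (nhds (g t).2) := fun t ht =>
    (continuous_snd.tendsto _).comp (hlim t ht)
  have hFu : ∀ t ∈ Icc 0 T, Tendsto (fun n => A t * F (φ n) (U (φ n) t)) atTop
      (nhds (A t * F₀ (g t).1)) := fun t ht => by
    refine Tendsto.const_mul _ ?_
    have h1 := squeeze_zero_norm (f := fun n => F (φ n) (U (φ n) t) - F₀ (U (φ n) t))
      (fun n => hFδ (φ n) (U (φ n) t)) (hδ.comp hφ.tendsto_atTop)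
    have h2 := h1.add ((hF₀.tendsto _).comp (hu t ht))
    simpa using h2
  refine ⟨fun t => (g t).1, fun t => (g t).2, ?_, ?_, ?_⟩
  · refine isShot_of_integral_eq hAc hF₀ hg.fst hg.snd hT fun t ht => ⟨?_, ?_⟩
    · refine tendsto_nhds_unique (hu t ht) ?_
      have h1 := (hu 0 h0T).add (tendsto_intervalIntegral_of_bounded ht
        (fun n => (hUV (φ n)).continuousOn_snd) (fun n => hVb (φ n)) hv)
      exact h1.congr fun n => ((hUV (φ n)).integral_eq hAc (hFc _) ht).1.symm
    · refine tendsto_nhds_unique (hv t ht) ?_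
      have h1 := (tendsto_intervalIntegral_of_bounded ht
        (fun n => hAc.continuousOn.mul ((hFc (φ n)).comp_continuousOn
          (hUV (φ n)).continuousOn_fst)) (fun n s _ => hAF (φ n) s _) hFu).neg
      exact h1.congr fun n => ((hUV (φ n)).integral_eq hAc (hFc _) ht).2.symm
  · exact isClosed_Icc.mem_of_tendsto (hu 0 h0T) (Eventually.of_forall fun n => hU0 (φ n))
  · refine tendsto_nhds_unique (hu T hTT) ?_
    have h1 := (tendsto_intervalIntegral_of_bounded hη
      (fun n => (hUV (φ n)).continuousOn_fst) (fun n => hUC (φ n)) hu).const_mul α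
    exact h1.congr fun n => (hbc (φ n)).symm

theorem stmt_10 (T η α : ℝ) (hη0 : 0 < η) (hηT : η < T)
    (hα0 : 0 < α) (hα1 : α < 1 / η)
    (f a : ℝ → ℝ)
    (hfc : ContinuousOn f (Ici 0)) (hfnn : ∀ x ∈ Ici (0:ℝ), 0 ≤ f x)
    (hac : ContinuousOn a (Icc 0 T)) (hann : ∀ t ∈ Icc (0:ℝ) T, 0 ≤ a t)
    (hapos : ∃ t₀ ∈ Icc (0:ℝ) T, 0 < a t₀)
    (hf0 : Tendsto (fun x => f x / x) (nhdsWithin 0 (Ioi 0)) (nhds 0))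
    (hfinf : Tendsto (fun x => f x / x) atTop atTop) :
    ∃ u : ℝ → ℝ, IsPosSol T η α f a u := by
  have hT : 0 < T := hη0.trans hηT
  have hηm : η ∈ Icc 0 T := ⟨hη0.le, hηT.le⟩
  have hαη : α * η < 1 := (lt_div_iff₀ hη0).1 hα1
  obtain ⟨M, hM, haM⟩ : ∃ M > 0, ∀ t ∈ Icc (0:ℝ) T, a t ≤ M := by
    obtain ⟨M, hM⟩ := isCompact_Icc.exists_bound_of_continuousOn hac
    exact ⟨max M 1, by positivity, fun t ht =>
      ((le_abs_self _).trans (hM t ht)).trans (le_max_left _ _)⟩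
  set A : ℝ → ℝ := fun t => a (projIcc 0 T hT.le t) with hAdef
  have hAc : Continuous A := hac.domRestrict.comp continuous_projIcc
  have hA : ∀ t, 0 ≤ A t := fun t => hann _ (projIcc 0 T hT.le t).2
  have hAM : ∀ t, A t ≤ M := fun t => haM _ (projIcc 0 T hT.le t).2
  have hAa : ∀ t ∈ Icc 0 T, A t = a t := fun t ht => by
    simp only [hAdef, projIcc_of_mem hT.le ht]
  obtain ⟨ε, p, q, hε, hp, hpq, hq, hAε⟩ : ∃ ε p q : ℝ, 0 < ε ∧ 0 ≤ p ∧ p < q ∧ q < T ∧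
      ∀ t ∈ Ioo p q, ε ≤ A t := by
    obtain ⟨t₀, ht₀, hpos⟩ := hapos
    rw [← hAa t₀ ht₀] at hpos
    have hopen : IsOpen {t | A t₀ / 2 < A t} := isOpen_lt continuous_const hAc
    rw [← closure_Ioo hT.ne] at ht₀
    obtain ⟨t₁, ht₁, ht₁'⟩ := mem_closure_iff.1 ht₀ _ hopen (half_lt_self hpos)
    obtain ⟨l, b, ht₁lb, hlb⟩ := mem_nhds_iff_exists_Ioo_subset.1
      ((hopen.inter isOpen_Ioo).mem_nhds ⟨ht₁, ht₁'⟩)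
    have hb := ht₁lb.2
    refine ⟨A t₀ / 2, t₁, (t₁ + b) / 2, half_pos hpos, ht₁'.1.le, by linarith, ?_, ?_⟩
    · exact (hlb (a := (t₁ + b) / 2) ⟨by linarith [ht₁lb.1], by linarith⟩).2.2
    · intro t ht
      exact (hlb (a := t) ⟨ht₁lb.1.trans ht.1, by linarith [ht.2]⟩).1.le
  set κ := α * η * (1 - η / T) with hκ
  have hκ0 : 0 < κ := by
    have : 0 < 1 - η / T := sub_pos.2 ((div_lt_one hT).2 hηT)
    positivity
  set θ := ε * (q - p) * (T - q) with hθ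
  have hθ0 : 0 < θ := mul_pos (mul_pos hε (sub_pos.2 hpq)) (sub_pos.2 hq)
  set ε₁ := (1 - α * η) / (4 * M * T * T) with hε₁
  have hε₁0 : 0 < ε₁ := div_pos (sub_pos.2 hαη) (by positivity)
  obtain ⟨r, hr, hfr⟩ : ∃ r > 0, ∀ x ∈ Icc 0 r, f x ≤ ε₁ * r := by
    obtain ⟨r, hr, hsub⟩ := (mem_nhdsGT_iff_exists_Ioc_subset (a := (0:ℝ))).1
      (hf0.eventually_lt_const hε₁0)
    have hpos : ∀ x ∈ Ioc 0 r, f x ≤ ε₁ * r := fun x hx => by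
      have h1 : f x / x < ε₁ := hsub hx
      rw [div_lt_iff₀ hx.1] at h1
      exact h1.le.trans (mul_le_mul_of_nonneg_left hx.2 hε₁0.le)
    refine ⟨r, hr, fun x hx => ?_⟩
    rcases hx.1.eq_or_lt with rfl | h0
    · refine le_of_tendsto ((hfc 0 self_mem_Ici).mono Ioi_subset_Ici_self) ?_
      filter_upwards [Ioc_mem_nhdsGT hr] with y hy using hpos y hy
    · exact hpos x ⟨h0, hx.2⟩
  obtain ⟨R₀, hR₀⟩ := eventually_atTop.1 (hfinf.eventually_ge_atTop (2 / (θ * κ)))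
  set R := max r (R₀ / κ) with hRdef
  have hrR : r ≤ R := le_max_left _ _
  have hRpos : 0 < R := hr.trans_le hrR
  have hfR : ∀ x, κ * R ≤ x → 2 / (θ * κ) * (κ * R) ≤ f x := fun x hx => by
    have hx0 : 0 < x := (mul_pos hκ0 hRpos).trans_le hx
    have h1 : R₀ ≤ κ * R := by
      have := (div_le_iff₀ hκ0).1 (le_max_right r (R₀ / κ))
      linarith
    have h2 := (le_div_iff₀ hx0).1 (hR₀ x (h1.trans hx))
    exact (mul_le_mul_of_nonneg_left hx (by positivity)).trans h2
  have hfcR : ContinuousOn f (Icc 0 R) := hfc.mono Icc_subset_Ici_self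
  obtain ⟨B, hB⟩ := isCompact_Icc.exists_bound_of_continuousOn hfcR
  set F₀ : ℝ → ℝ := fun x => f (projIcc 0 R hRpos.le x) with hF₀def
  have hF₀c : Continuous F₀ := hfcR.domRestrict.comp continuous_projIcc
  have hF₀ : ∀ x, 0 ≤ F₀ x := fun x => hfnn _ (projIcc 0 R hRpos.le x).2.1
  have hF₀f : ∀ x ∈ Icc 0 R, F₀ x = f x := fun x hx => by
    simp only [hF₀def, projIcc_of_mem hRpos.le hx]
  have hF₀B : ∀ x, F₀ x ≤ B := fun x =>
    (le_abs_self _).trans (hB _ (projIcc 0 R hRpos.le x).2)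
  have hF₀r : ∀ x ≤ r, F₀ x ≤ ε₁ * r := fun x hx => by
    refine hfr _ ⟨(projIcc 0 R hRpos.le x).2.1, ?_⟩
    rw [coe_projIcc]
    exact max_le hr.le ((min_le_right _ _).trans hx)
  have hδ0 : 0 < ε₁ * r := mul_pos hε₁0 hr
  have hδn : ∀ n : ℕ, 0 < ε₁ * r * (1 / ((n:ℝ) + 1)) := fun n => by positivity
  have hδle : ∀ n : ℕ, ε₁ * r * (1 / ((n:ℝ) + 1)) ≤ ε₁ * r := fun n =>
    mul_le_of_le_one_right hδ0.le (by
      rw [div_le_one (by positivity)]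
      linarith [n.cast_nonneg (α := ℝ)])
  choose K F hFK hFF₀ using fun n : ℕ => exists_lipschitz_approx hRpos.le (hδn n) hfcR
  have hFlo : ∀ n x, F₀ x ≤ F n x := fun n x => (hFF₀ n x).1
  have hFhi : ∀ n x, F n x ≤ F₀ x + ε₁ * r * (1 / ((n:ℝ) + 1)) := fun n x => (hFF₀ n x).2
  have hF : ∀ n x, 0 ≤ F n x := fun n x => (hF₀ x).trans (hFlo n x)
  have hFB : ∀ n x, F n x ≤ B + ε₁ * r := fun n x => by
    linarith [hFhi n x, hδle n, hF₀B x]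
  have happrox : ∀ n, ∃ u v, IsShot T A (F n) u v ∧ u 0 ∈ Icc r R ∧
      u T = α * ∫ s in (0:ℝ)..η, u s := fun n => by
    obtain ⟨U, V, hUV, hcont⟩ := exists_isShot_family (α := α) hT.le hηm hAc hA hAM (hFK n)
      (hF n) (hFB n) hRpos.le
    obtain ⟨hr1, hr2⟩ := hUV r ⟨hr.le, hrR⟩
    obtain ⟨hR1, hR2⟩ := hUV R ⟨hRpos.le, le_rfl⟩
    have hsmall := hr1.lt_of_small hA (hF n) hηm hα0 (m := 2 * (ε₁ * r)) (by positivity) hAM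
      (fun x hx => by
        rw [hr2] at hx
        linarith [hFhi n x, hδle n, hF₀r x hx])
      (by
        rw [hr2]
        have : M * (2 * (ε₁ * r)) * T * T = (1 - α * η) * r / 2 := by
          rw [hε₁]
          field_simp
          ring
        rw [this]
        exact half_lt_self (mul_pos (sub_pos.2 hαη) hr))
    have hlarge := hR1.lt_of_large hA (hF n) hη0 hηT hα0 hαη hp hpq.le hq.le hAε
      (K := 2 / (θ * κ) * (κ * R)) (by positivity)
      (fun x hx hx' => by
        rw [hR2] at hx hx'
        rw [← hκ] at hx
        have hx0 : 0 ≤ x := (mul_pos hκ0 hRpos).le.trans hx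
        exact (hfR x hx).trans ((hF₀f x ⟨hx0, hx'⟩).symm.le.trans (hFlo n x)))
      (by
        rw [hR2]
        have : ε * (2 / (θ * κ) * (κ * R)) * (q - p) * (T - q) = 2 * R := by
          calc ε * (2 / (θ * κ) * (κ * R)) * (q - p) * (T - q)
              = 2 / (θ * κ) * (κ * R) * θ := by rw [hθ]; ring
            _ = 2 * R := by field_simp
        linarith)
    obtain ⟨c, hc, hc0⟩ := intermediate_value_Icc' hrR
      (hcont.mono (Icc_subset_Icc hr.le le_rfl))
      (⟨(sub_neg.2 hlarge).le, (sub_pos.2 hsmall).le⟩ : (0:ℝ) ∈ Icc _ _)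
    obtain ⟨hc1, hc2⟩ := hUV c ⟨hr.le.trans hc.1, hc.2⟩
    exact ⟨U c, V c, hc1, by rwa [hc2], sub_eq_zero.1 hc0⟩
  choose U V hUV hU0 hbc using happrox
  have hδlim : Tendsto (fun n : ℕ => ε₁ * r * (1 / ((n:ℝ) + 1))) atTop (nhds 0) := by
    simpa using tendsto_one_div_add_atTop_nhds_zero_nat.const_mul (ε₁ * r)
  obtain ⟨u, v, huv, hu0, hubc⟩ := exists_isShot_limit hT.le hηm hAc hA hAM hF₀c hδlim
    (fun n => (hFK n).continuous) hF hFB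
    (fun n x => abs_le.2 ⟨by linarith [hFlo n x, hδn n], by linarith [hFhi n x]⟩) hUV hU0 hbc
  have huT : 0 < u T := (mul_pos hκ0 (hr.trans_le hu0.1)).trans_le
    (huv.cone_le hA hF₀ hη0 hηT hα0 hαη hubc.ge).2
  have hpos : ∀ t ∈ Icc (0:ℝ) T, 0 < u t := fun t ht =>
    huT.trans_le (huv.fst_antitone hA hF₀ ht (right_mem_Icc.2 hT.le) ht.2)
  refine ⟨u, hpos, v, fun t => -(A t * F₀ (u t)), huv.deriv_fst, huv.deriv_snd, ?_,
    huv.snd_zero, hubc⟩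
  intro t ht
  have htm := Ioo_subset_Icc_self ht
  have hle : u t ≤ R :=
    (huv.fst_antitone hA hF₀ (left_mem_Icc.2 hT.le) htm htm.1).trans hu0.2
  beta_reduce
  rw [hAa t htm, hF₀f _ ⟨(hpos t htm).le, hle⟩, neg_add_cancel]
end
end

section
/- Assume T, η, α are real constants with 0 < η < T and 0 < α < 1/η, f satisfies (B1), a satisfies (B2), and additionally: (H7) there exists θ₁ ∈ (0,1] such that f₀ = α₁ ∈ [0, θ₁Λ₁); and (H8) there exists θ₂ ≥ 1 such that f∞ = β₁ ∈ ((θ₂/γ)Λ₂, ∞). Then the BVP u''(t) + a(t)f(u(t)) = 0 on (0,T), u'(0) = 0, u(T) = α ∫₀^η u(s) ds has at least one positive solution. -/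
open Set MeasureTheory Filter

noncomputable section

/-- The function with second derivative `y`, vanishing at `0` together with its first derivative. -/
def volterra (y : ℝ → ℝ) (t : ℝ) : ℝ := ∫ s in (0:ℝ)..t, (t - s) * y s

lemma volterra_eq {y : ℝ → ℝ} (hy : Continuous y) (t : ℝ) :
    volterra y t = t * (∫ s in (0:ℝ)..t, y s) - ∫ s in (0:ℝ)..t, s * y s := by
  unfold volterra
  rw [← intervalIntegral.integral_const_mul, ← intervalIntegral.integral_sub]
  · simp only [sub_mul]
  · exact (by fun_prop : Continuous fun s => t * y s).intervalIntegrable _ _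
  · exact (by fun_prop : Continuous fun s => s * y s).intervalIntegrable _ _

lemma hasDerivAt_volterra {y : ℝ → ℝ} (hy : Continuous y) (t : ℝ) :
    HasDerivAt (volterra y) (∫ s in (0:ℝ)..t, y s) t := by
  have h1 := (hy.integral_hasStrictDerivAt 0 t).hasDerivAt
  have h2 := ((by fun_prop : Continuous fun s => s * y s).integral_hasStrictDerivAt 0 t).hasDerivAt
  have h := ((hasDerivAt_id t).mul h1).sub h2
  rw [funext (volterra_eq hy)]
  refine HasDerivAt.congr_deriv h ?_
  simp

lemma continuous_volterra {y : ℝ → ℝ} (hy : Continuous y) : Continuous (volterra y) :=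
  continuous_iff_continuousAt.2 fun t => (hasDerivAt_volterra hy t).continuousAt

lemma integral_volterra {y : ℝ → ℝ} (hy : Continuous y) (t : ℝ) :
    ∫ r in (0:ℝ)..t, volterra y r = ∫ s in (0:ℝ)..t, (t - s) ^ 2 / 2 * y s := by
  have key : ∀ r, HasDerivAt (fun r => r ^ 2 / 2 * (∫ s in (0:ℝ)..r, y s)
      - r * (∫ s in (0:ℝ)..r, s * y s) + ∫ s in (0:ℝ)..r, s ^ 2 / 2 * y s) (volterra y r) r := by
    intro r
    have h1 := (hy.integral_hasStrictDerivAt 0 r).hasDerivAt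
    have h2 :=
      ((by fun_prop : Continuous fun s => s * y s).integral_hasStrictDerivAt 0 r).hasDerivAt
    have h3 :=
      ((by fun_prop : Continuous fun s => s ^ 2 / 2 * y s).integral_hasStrictDerivAt 0 r).hasDerivAt
    have h := (((((hasDerivAt_id r).pow 2).div_const 2).mul h1).sub
      ((hasDerivAt_id r).mul h2)).add h3
    refine HasDerivAt.congr_deriv h ?_
    rw [volterra_eq hy]
    simp
    ring
  rw [intervalIntegral.integral_eq_sub_of_hasDerivAt (fun r _ => key r)
    ((continuous_volterra hy).intervalIntegrable _ _)]
  rw [← intervalIntegral.integral_const_mul, ← intervalIntegral.integral_const_mul,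
    ← intervalIntegral.integral_sub, ← intervalIntegral.integral_add]
  · simp only [intervalIntegral.integral_same, mul_zero, sub_zero, add_zero]
    congr 1
    ext s
    ring
  all_goals exact Continuous.intervalIntegrable (by fun_prop) _ _

lemma volterra_mono {y z : ℝ → ℝ} (hy : Continuous y) (hz : Continuous z) {t : ℝ} (ht : 0 ≤ t)
    (h : ∀ s ∈ Icc 0 t, y s ≤ z s) : volterra y t ≤ volterra z t := by
  refine intervalIntegral.integral_mono_on ht (Continuous.intervalIntegrable (by fun_prop) _ _)
    (Continuous.intervalIntegrable (by fun_prop) _ _) fun s hs => ?_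
  exact mul_le_mul_of_nonneg_left (h s hs) (by linarith [hs.2])

lemma volterra_const_mul (k : ℝ) (y : ℝ → ℝ) (t : ℝ) :
    volterra (fun s => k * y s) t = k * volterra y t := by
  unfold volterra
  rw [← intervalIntegral.integral_const_mul]
  congr 1
  ext s
  ring

lemma volterra_nonneg {y : ℝ → ℝ} (hy0 : ∀ s, 0 ≤ y s) {t : ℝ} (ht : 0 ≤ t) :
    0 ≤ volterra y t :=
  intervalIntegral.integral_nonneg ht fun s hs => mul_nonneg (by linarith [hs.2]) (hy0 s)

lemma monotoneOn_volterra {y : ℝ → ℝ} (hy : Continuous y) (hy0 : ∀ s, 0 ≤ y s) :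
    MonotoneOn (volterra y) (Ici 0) := by
  refine monotoneOn_of_deriv_nonneg (convex_Ici 0) (continuous_volterra hy).continuousOn
    (fun t _ => (hasDerivAt_volterra hy t).differentiableAt.differentiableWithinAt) fun t ht => ?_
  rw [interior_Ici] at ht
  rw [(hasDerivAt_volterra hy t).deriv]
  exact intervalIntegral.integral_nonneg (le_of_lt ht) fun s _ => hy0 s

lemma volterra_mul_le {y : ℝ → ℝ} (hy : Continuous y) (hy0 : ∀ s, 0 ≤ y s) {r t : ℝ}
    (hr : 0 ≤ r) (hrt : r ≤ t) : t * volterra y r ≤ r * volterra y t := by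
  have hsplit : volterra y t = (∫ s in (0:ℝ)..r, (t - s) * y s) + ∫ s in r..t, (t - s) * y s :=
    (intervalIntegral.integral_add_adjacent_intervals
      (Continuous.intervalIntegrable (by fun_prop) _ _)
      (Continuous.intervalIntegrable (by fun_prop) _ _)).symm
  have h1 : 0 ≤ ∫ s in r..t, (t - s) * y s :=
    intervalIntegral.integral_nonneg hrt fun s hs => mul_nonneg (by linarith [hs.2]) (hy0 s)
  have h2 : t * volterra y r ≤ r * ∫ s in (0:ℝ)..r, (t - s) * y s := by
    unfold volterra
    rw [← intervalIntegral.integral_const_mul, ← intervalIntegral.integral_const_mul]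
    refine intervalIntegral.integral_mono_on hr (Continuous.intervalIntegrable (by fun_prop) _ _)
      (Continuous.intervalIntegrable (by fun_prop) _ _) fun s hs => ?_
    have := mul_nonneg (mul_nonneg hs.1 (sub_nonneg.2 hrt)) (hy0 s)
    nlinarith
  rw [hsplit]
  nlinarith [mul_nonneg hr h1]

lemma abs_volterra_sub_le {y : ℝ → ℝ} (hy : Continuous y) {T B : ℝ}
    (hB : ∀ s ∈ Icc 0 T, |y s| ≤ B) {r t : ℝ} (hr : r ∈ Icc 0 T) (ht : t ∈ Icc 0 T) :
    |volterra y t - volterra y r| ≤ B * T * |t - r| := by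
  have hT : 0 ≤ T := hr.1.trans hr.2
  have hB0 : 0 ≤ B := (abs_nonneg _).trans (hB 0 ⟨le_rfl, hT⟩)
  refine (convex_Icc 0 T).norm_image_sub_le_of_norm_hasDerivWithin_le
    (f' := fun t => ∫ s in (0:ℝ)..t, y s)
    (fun x _ => (hasDerivAt_volterra hy x).hasDerivWithinAt) (fun x hx => ?_) hr ht
  have := intervalIntegral.norm_integral_le_of_norm_le_const (a := 0) (b := x) (f := y) (C := B)
    fun s hs => by
      rw [uIoc_of_le hx.1] at hs
      exact hB s ⟨hs.1.le, hs.2.trans hx.2⟩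
  rw [sub_zero, abs_of_nonneg hx.1] at this
  exact this.trans (mul_le_mul_of_nonneg_left hx.2 hB0)

/-- Picard iterates for `u = c - volterra (A * g ∘ u)` with the argument of `g` delayed by `h`. -/
def delayIter (A g : ℝ → ℝ) (h : ℝ) : ℕ → ℝ → ℝ → ℝ
  | 0, c, _ => c
  | k + 1, c, t => c - volterra (fun s => A s * g (delayIter A g h k c (max (s - h) 0))) t

lemma continuous_delayIter {A g : ℝ → ℝ} (hA : Continuous A) (hg : Continuous g) (h : ℝ) (k : ℕ) :
    Continuous fun p : ℝ × ℝ => delayIter A g h k p.1 p.2 := by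
  induction k with
  | zero => exact continuous_fst
  | succ k ih =>
    refine continuous_fst.sub ?_
    unfold volterra
    refine intervalIntegral.continuous_parametric_intervalIntegral_of_continuous (μ := volume)
      (f := fun (p : ℝ × ℝ) s => (p.2 - s) * (A s * g (delayIter A g h k p.1 (max (s - h) 0))))
      ?_ continuous_snd
    have : Continuous fun q : (ℝ × ℝ) × ℝ => delayIter A g h k q.1.1 (max (q.2 - h) 0) :=
      ih.comp (by fun_prop : Continuous fun q : (ℝ × ℝ) × ℝ => (q.1.1, max (q.2 - h) 0))
    show Continuous fun q : (ℝ × ℝ) × ℝ =>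
      (q.1.2 - q.2) * (A q.2 * g (delayIter A g h k q.1.1 (max (q.2 - h) 0)))
    fun_prop

lemma volterra_congr {y z : ℝ → ℝ} {t : ℝ} (ht : 0 ≤ t) (h : ∀ s ∈ Icc 0 t, y s = z s) :
    volterra y t = volterra z t := by
  refine intervalIntegral.integral_congr fun s hs => ?_
  rw [uIcc_of_le ht] at hs
  simp only [h s hs]

lemma delayIter_succ_eq (A g : ℝ → ℝ) {h : ℝ} (hh : 0 ≤ h) (k : ℕ) (c : ℝ) :
    ∀ t, 0 ≤ t → t ≤ k * h → delayIter A g h (k + 1) c t = delayIter A g h k c t := by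
  induction k with
  | zero =>
    intro t ht0 ht
    obtain rfl : t = 0 := le_antisymm (by simpa using ht) ht0
    simp [delayIter, volterra]
  | succ k ih =>
    intro t ht0 ht
    rw [delayIter, delayIter]
    congr 1
    refine volterra_congr ht0 fun s hs => ?_
    rw [ih _ (le_max_right _ _)]
    push_cast at ht
    exact max_le (by linarith [hs.2]) (by positivity)

lemma exists_delay_solution {A g : ℝ → ℝ} (hA : Continuous A) (hg : Continuous g) {h : ℝ}
    (hh : 0 < h) (T : ℝ) :
    ∃ w : ℝ → ℝ → ℝ, Continuous (fun p : ℝ × ℝ => w p.1 p.2) ∧ ∀ c, ∀ t ∈ Icc 0 T,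
      w c t = c - volterra (fun s => A s * g (w c (max (s - h) 0))) t := by
  obtain ⟨k, hk⟩ := exists_nat_ge (T / h)
  rw [div_le_iff₀ hh] at hk
  refine ⟨delayIter A g h k, continuous_delayIter hA hg h k, fun c t ht => ?_⟩
  rw [← delayIter_succ_eq A g hh.le k c t ht.1 (ht.2.trans hk), delayIter]

lemma gammaBVP_mul_le {T η α c : ℝ} (hη0 : 0 < η) (hηT : η < T) (hα0 : 0 < α) (hp : α * η < 1)
    {y : ℝ → ℝ} (hy : Continuous y) (hy0 : ∀ s, 0 ≤ y s)
    (h : α * ∫ s in (0:ℝ)..η, (c - volterra y s) ≤ c - volterra y T) :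
    gammaBVP T η α * c ≤ c - volterra y T := by
  have hVc := continuous_volterra hy
  have h1 : ∫ s in (0:ℝ)..η, (c - volterra y η) ≤ ∫ s in (0:ℝ)..η, (c - volterra y s) := by
    refine intervalIntegral.integral_mono_on hη0.le (Continuous.intervalIntegrable (by fun_prop) _ _)
      (Continuous.intervalIntegrable (by fun_prop) _ _) fun s hs => ?_
    have := monotoneOn_volterra hy hy0 (show s ∈ Ici 0 from hs.1) (show η ∈ Ici 0 from hη0.le) hs.2
    linarith
  rw [intervalIntegral.integral_const, smul_eq_mul, sub_zero] at h1
  have h2 := volterra_mul_le hy hy0 hη0.le hηT.le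
  have hD : 0 < T - α * η ^ 2 := by nlinarith
  have hT : 0 < T := hη0.trans hηT
  unfold gammaBVP
  rw [div_mul_eq_mul_div, div_le_iff₀ hD]
  have h3 : α * (η * (c - volterra y η)) ≤ c - volterra y T :=
    (mul_le_mul_of_nonneg_left h1 hα0.le).trans h
  have h4 := mul_le_mul_of_nonneg_left h3 hT.le
  have h5 := mul_le_mul_of_nonneg_left h2 (mul_pos hα0 hη0).le
  nlinarith

/-- The functional of `a` in the denominator of `lambda2`. -/
def weightIntegral (T η α : ℝ) (y : ℝ → ℝ) : ℝ :=
  (∫ s in η..T, (T - s) * y s) +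
    (1 / 2) * ∫ s in (0:ℝ)..η, (2 * (T - η) + α * (η ^ 2 - s ^ 2)) * y s

lemma weightIntegral_le {T η α : ℝ} (hη0 : 0 < η) (hp : α * η ≤ 1)
    {y : ℝ → ℝ} (hy : Continuous y) (hy0 : ∀ s, 0 ≤ y s) :
    weightIntegral T η α y ≤ volterra y T - α * ∫ s in (0:ℝ)..η, volterra y s := by
  have hsplit : volterra y T = (∫ s in (0:ℝ)..η, (T - s) * y s) + ∫ s in η..T, (T - s) * y s :=
    (intervalIntegral.integral_add_adjacent_intervals
      (Continuous.intervalIntegrable (by fun_prop) _ _)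
      (Continuous.intervalIntegrable (by fun_prop) _ _)).symm
  have key : (1 / 2) * ∫ s in (0:ℝ)..η, (2 * (T - η) + α * (η ^ 2 - s ^ 2)) * y s ≤
      (∫ s in (0:ℝ)..η, (T - s) * y s) - α * ∫ s in (0:ℝ)..η, (η - s) ^ 2 / 2 * y s := by
    rw [← intervalIntegral.integral_const_mul, ← intervalIntegral.integral_const_mul,
      ← intervalIntegral.integral_sub (Continuous.intervalIntegrable (by fun_prop) _ _)
      (Continuous.intervalIntegrable (by fun_prop) _ _)]
    refine intervalIntegral.integral_mono_on hη0.le (Continuous.intervalIntegrable (by fun_prop) _ _)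
      (Continuous.intervalIntegrable (by fun_prop) _ _) fun s hs => ?_
    have := mul_nonneg (mul_nonneg (sub_nonneg.2 hs.2) (sub_nonneg.2 hp)) (hy0 s)
    nlinarith
  rw [integral_volterra hy, hsplit, weightIntegral]
  linarith

lemma weightIntegral_mono {T η α : ℝ} (hη0 : 0 < η) (hηT : η < T) (hα0 : 0 < α)
    {y z : ℝ → ℝ} (hy : Continuous y) (hz : Continuous z) (h : ∀ s ∈ Icc 0 T, y s ≤ z s) :
    weightIntegral T η α y ≤ weightIntegral T η α z := by
  refine add_le_add ?_ (mul_le_mul_of_nonneg_left ?_ (by norm_num))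
  · refine intervalIntegral.integral_mono_on hηT.le (Continuous.intervalIntegrable (by fun_prop) _ _)
      (Continuous.intervalIntegrable (by fun_prop) _ _) fun s hs => ?_
    exact mul_le_mul_of_nonneg_left (h s ⟨hη0.le.trans hs.1, hs.2⟩) (by linarith [hs.2])
  · refine intervalIntegral.integral_mono_on hη0.le (Continuous.intervalIntegrable (by fun_prop) _ _)
      (Continuous.intervalIntegrable (by fun_prop) _ _) fun s hs => ?_
    refine mul_le_mul_of_nonneg_left (h s ⟨hs.1, hs.2.trans hηT.le⟩) ?_
    have : s ^ 2 ≤ η ^ 2 := pow_le_pow_left₀ hs.1 hs.2 2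
    have := mul_nonneg hα0.le (sub_nonneg.2 this)
    linarith

lemma weightIntegral_const_mul (T η α k : ℝ) (y : ℝ → ℝ) :
    weightIntegral T η α (fun s => k * y s) = k * weightIntegral T η α y := by
  unfold weightIntegral
  simp only [mul_left_comm _ k, intervalIntegral.integral_const_mul]
  ring

lemma volterra_le_weightIntegral {T η α : ℝ} (hη0 : 0 < η) (hηT : η < T) (hα0 : 0 < α)
    {y : ℝ → ℝ} (hy : Continuous y) (hy0 : ∀ s, 0 ≤ y s) :
    (T - η) / T * volterra y T ≤ weightIntegral T η α y := by
  have hT : 0 < T := hη0.trans hηT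
  have hr : (T - η) / T ≤ 1 := (div_le_one hT).2 (by linarith)
  have hr0 : 0 ≤ (T - η) / T := div_nonneg (by linarith) hT.le
  have hrT : (T - η) / T * T = T - η := div_mul_cancel₀ _ hT.ne'
  have hsplit : volterra y T = (∫ s in (0:ℝ)..η, (T - s) * y s) + ∫ s in η..T, (T - s) * y s :=
    (intervalIntegral.integral_add_adjacent_intervals
      (Continuous.intervalIntegrable (by fun_prop) _ _)
      (Continuous.intervalIntegrable (by fun_prop) _ _)).symm
  rw [hsplit, mul_add, add_comm, weightIntegral]
  refine add_le_add ?_ ?_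
  · refine mul_le_of_le_one_left ?_ hr
    exact intervalIntegral.integral_nonneg hηT.le fun s hs => mul_nonneg (by linarith [hs.2]) (hy0 s)
  · rw [← intervalIntegral.integral_const_mul, ← intervalIntegral.integral_const_mul]
    refine intervalIntegral.integral_mono_on hη0.le (Continuous.intervalIntegrable (by fun_prop) _ _)
      (Continuous.intervalIntegrable (by fun_prop) _ _) fun s hs => ?_
    rw [← mul_assoc, ← mul_assoc]
    refine mul_le_mul_of_nonneg_right ?_ (hy0 s)
    have : s ^ 2 ≤ η ^ 2 := pow_le_pow_left₀ hs.1 hs.2 2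
    have := mul_nonneg hα0.le (sub_nonneg.2 this)
    have := mul_nonneg hr0 hs.1
    nlinarith

lemma exists_delay_solution_bvp {T η α : ℝ} (hη0 : 0 < η) (hηT : η < T) (hα0 : 0 < α)
    (hp : α * η < 1) {A g : ℝ → ℝ} (hA : Continuous A) (hA0 : ∀ s, 0 ≤ A s) (hg : Continuous g)
    (hg0 : ∀ x, 0 ≤ g x) {c₀ c₁ m₀ m₁ : ℝ} (hc₀ : 0 < c₀) (hc : c₀ ≤ c₁)
    (hm₀ : ∀ x ≤ c₀, g x ≤ m₀ * c₀) (hm₀' : m₀ * volterra A T ≤ 1 - α * η)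
    (hm₁ : ∀ x, gammaBVP T η α * c₁ ≤ x → m₁ * c₁ ≤ g x)
    (hm₁' : 1 - α * η < m₁ * weightIntegral T η α A) {h : ℝ} (hh : 0 < h) :
    ∃ u : ℝ → ℝ, Continuous u ∧
      (∀ t ∈ Icc 0 T, u t = u 0 - volterra (fun s => A s * g (u (max (s - h) 0))) t) ∧
      u T = α * (∫ s in (0:ℝ)..η, u s) ∧
      ∀ t ∈ Icc 0 T, u t ∈ Icc (gammaBVP T η α * c₀) c₁ := by
  obtain ⟨w, hwc, hw⟩ := exists_delay_solution hA hg hh T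
  have hT : 0 < T := hη0.trans hηT
  have hwc' : ∀ c, Continuous (w c) := fun c => hwc.comp (by fun_prop : Continuous fun t => (c, t))
  set y : ℝ → ℝ → ℝ := fun c s => A s * g (w c (max (s - h) 0)) with hydef
  have hy : ∀ c, Continuous (y c) := fun c => by
    have := hwc' c
    fun_prop
  have hy0 : ∀ c s, 0 ≤ y c s := fun c s => mul_nonneg (hA0 _) (hg0 _)
  have hint : ∀ c, ∫ s in (0:ℝ)..η, w c s = ∫ s in (0:ℝ)..η, (c - volterra (y c) s) := fun c => by
    refine intervalIntegral.integral_congr fun s hs => ?_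
    rw [uIcc_of_le hη0.le] at hs
    exact hw c s ⟨hs.1, hs.2.trans hηT.le⟩
  have hint' : ∀ c, ∫ s in (0:ℝ)..η, (c - volterra (y c) s)
      = η * c - ∫ s in (0:ℝ)..η, volterra (y c) s := fun c => by
    rw [intervalIntegral.integral_sub (Continuous.intervalIntegrable (by fun_prop) _ _)
      ((continuous_volterra (hy c)).intervalIntegrable _ _)]
    simp
  have hTmem : T ∈ Icc 0 T := ⟨hT.le, le_rfl⟩
  have hle : ∀ c, ∀ t ∈ Icc 0 T, w c t ≤ c := fun c t ht => by
    rw [hw c t ht]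
    linarith [volterra_nonneg (hy0 c) ht.1]
  have hge : ∀ c, ∀ t ∈ Icc 0 T, w c T ≤ w c t := fun c t ht => by
    rw [hw c t ht, hw c T hTmem]
    have := monotoneOn_volterra (hy c) (hy0 c) (show t ∈ Ici 0 from ht.1)
      (show T ∈ Ici 0 from hT.le) ht.2
    linarith
  have hdelay : ∀ s ∈ Icc 0 T, max (s - h) 0 ∈ Icc 0 T := fun s hs =>
    ⟨le_max_right _ _, max_le (by linarith [hs.2]) hT.le⟩
  have hgamma : ∀ c, α * (∫ s in (0:ℝ)..η, w c s) ≤ w c T → gammaBVP T η α * c ≤ w c T := by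
    intro c h
    rw [hint, hw c T hTmem] at h
    rw [hw c T hTmem]
    exact gammaBVP_mul_le hη0 hηT hα0 hp (hy c) (hy0 c) h
  set Φ : ℝ → ℝ := fun c => w c T - α * ∫ s in (0:ℝ)..η, w c s with hΦ
  have hΦc : Continuous Φ := by
    have h1 : Continuous fun c => w c T := hwc.comp (by fun_prop : Continuous fun c => (c, T))
    have h2 : Continuous fun c => ∫ s in (0:ℝ)..η, w c s :=
      intervalIntegral.continuous_parametric_intervalIntegral_of_continuous' hwc _ _
    fun_prop
  have hΦ0 : 0 ≤ Φ c₀ := by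
    have h1 : volterra (y c₀) T ≤ m₀ * c₀ * volterra A T := by
      rw [← volterra_const_mul]
      refine volterra_mono (hy c₀) (by fun_prop) hT.le fun s hs => ?_
      have := mul_le_mul_of_nonneg_left (hm₀ _ (hle c₀ _ (hdelay s hs))) (hA0 s)
      linarith
    have h2 : 0 ≤ ∫ s in (0:ℝ)..η, volterra (y c₀) s :=
      intervalIntegral.integral_nonneg hη0.le fun s hs => volterra_nonneg (hy0 c₀) hs.1
    simp only [hΦ]
    rw [hint, hint', hw c₀ T hTmem]
    have h3 := mul_le_mul_of_nonneg_left hm₀' hc₀.le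
    have h4 := mul_nonneg hα0.le h2
    change 0 ≤ c₀ - volterra (y c₀) T - _
    nlinarith
  have hΦ1 : Φ c₁ ≤ 0 := by
    by_contra! hcon
    have h0 := hgamma c₁ (by simp only [hΦ] at hcon; linarith)
    have h1 : m₁ * c₁ * weightIntegral T η α A ≤ weightIntegral T η α (y c₁) := by
      rw [← weightIntegral_const_mul]
      refine weightIntegral_mono hη0 hηT hα0 (by fun_prop) (hy c₁) fun s hs => ?_
      have := mul_le_mul_of_nonneg_left
        (hm₁ _ (h0.trans (hge c₁ _ (hdelay s hs)))) (hA0 s)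
      linarith
    have h2 := weightIntegral_le (T := T) hη0 hp.le (hy c₁) (hy0 c₁)
    simp only [hΦ] at hcon
    rw [hint, hint', hw c₁ T hTmem] at hcon
    change 0 < c₁ - volterra (y c₁) T - _ at hcon
    have h3 := mul_lt_mul_of_pos_left hm₁' (hc₀.trans_le hc)
    nlinarith
  obtain ⟨c, hcmem, hc0⟩ := intermediate_value_Icc' hc hΦc.continuousOn ⟨hΦ1, hΦ0⟩
  have hbc : w c T = α * ∫ s in (0:ℝ)..η, w c s := sub_eq_zero.1 hc0
  have hw0 : w c 0 = c := by
    rw [hw c 0 ⟨le_rfl, hT.le⟩]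
    simp [volterra]
  refine ⟨w c, hwc' c, fun t ht => by rw [hw0]; exact hw c t ht, hbc, fun t ht => ⟨?_, ?_⟩⟩
  · have hγ : 0 ≤ gammaBVP T η α :=
      div_nonneg (mul_nonneg (mul_pos hα0 hη0).le (by linarith)) (by nlinarith)
    exact (mul_le_mul_of_nonneg_left hcmem.1 hγ).trans
      ((hgamma c hbc.ge).trans (hge c t ht))
  · exact (hle c t ht).trans hcmem.2

lemma exists_uniform_limit_of_lipschitz {T m M K : ℝ} (hT : 0 ≤ T) {u : ℕ → ℝ → ℝ}
    (hu : ∀ n, Continuous (u n)) (hb : ∀ n, ∀ t ∈ Icc 0 T, u n t ∈ Icc m M)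
    (hK : ∀ n, ∀ r ∈ Icc 0 T, ∀ t ∈ Icc 0 T, |u n t - u n r| ≤ K * |t - r|) :
    ∃ φ : ℕ → ℕ, StrictMono φ ∧ ∃ v : ℝ → ℝ, Continuous v ∧
      TendstoUniformlyOn (fun n => u (φ n)) v atTop (Icc 0 T) := by
  let F : ℕ → BoundedContinuousFunction (Icc (0:ℝ) T) ℝ := fun n =>
    BoundedContinuousFunction.mkOfCompact ⟨fun t => u n t, (hu n).comp continuous_subtype_val⟩
  have hcomp : IsCompact (closure (range F)) := by
    refine BoundedContinuousFunction.arzela_ascoli (Icc m M) isCompact_Icc _ ?_ ?_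
    · rintro _ x ⟨n, rfl⟩
      exact hb n x x.2
    · refine Metric.equicontinuous_of_continuity_modulus (fun d => K * d) ?_ _ ?_
      · exact Continuous.tendsto' (by fun_prop) _ _ (mul_zero K)
      · rintro x y ⟨_, n, rfl⟩
        exact hK n y y.2 x x.2
  obtain ⟨v, -, φ, hφ, hv⟩ := hcomp.tendsto_subseq fun n => subset_closure (mem_range_self (f := F) n)
  refine ⟨φ, hφ, IccExtend hT v, v.continuous.Icc_extend', ?_⟩
  rw [BoundedContinuousFunction.tendsto_iff_tendstoUniformly] at hv
  rw [tendstoUniformlyOn_iff_tendstoUniformly_comp_coe]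
  have hcoe : IccExtend hT v ∘ ((↑) : Icc (0:ℝ) T → ℝ) = v :=
    funext fun t => IccExtend_val hT v t
  rw [hcoe]
  exact hv

lemma tendsto_volterra {y : ℕ → ℝ → ℝ} {z : ℝ → ℝ} {t B : ℝ} (ht : 0 ≤ t)
    (hy : ∀ n, Continuous (y n)) (hB : ∀ n, ∀ s ∈ Icc 0 t, |y n s| ≤ B)
    (hz : ∀ s ∈ Icc 0 t, Tendsto (fun n => y n s) atTop (nhds (z s))) :
    Tendsto (fun n => volterra (y n) t) atTop (nhds (volterra z t)) := by
  refine intervalIntegral.tendsto_integral_filter_of_dominated_convergence (fun _ => t * B)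
    (Eventually.of_forall fun n =>
      (by have := hy n; fun_prop : Continuous fun s => (t - s) * y n s).aestronglyMeasurable)
    (Eventually.of_forall fun n => Eventually.of_forall fun s hs => ?_)
    intervalIntegrable_const (Eventually.of_forall fun s hs => ?_)
  all_goals rw [uIoc_of_le ht] at hs
  · rw [norm_mul, Real.norm_eq_abs, Real.norm_eq_abs, abs_of_nonneg (by linarith [hs.2])]
    exact mul_le_mul (by linarith [hs.1]) (hB n s ⟨hs.1.le, hs.2⟩) (abs_nonneg _) ht
  · exact (hz s ⟨hs.1.le, hs.2⟩).const_mul _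

lemma exists_solution_bvp {T η α : ℝ} (hη0 : 0 < η) (hηT : η < T) (hα0 : 0 < α)
    (hp : α * η < 1) {A g : ℝ → ℝ} (hA : Continuous A) (hA0 : ∀ s, 0 ≤ A s) (hg : Continuous g)
    (hg0 : ∀ x, 0 ≤ g x) {c₀ c₁ m₀ m₁ : ℝ} (hc₀ : 0 < c₀) (hc : c₀ ≤ c₁)
    (hm₀ : ∀ x ≤ c₀, g x ≤ m₀ * c₀) (hm₀' : m₀ * volterra A T ≤ 1 - α * η)
    (hm₁ : ∀ x, gammaBVP T η α * c₁ ≤ x → m₁ * c₁ ≤ g x)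
    (hm₁' : 1 - α * η < m₁ * weightIntegral T η α A) :
    ∃ u : ℝ → ℝ, Continuous u ∧
      (∀ t ∈ Icc 0 T, u t = u 0 - volterra (fun s => A s * g (u s)) t) ∧
      u T = α * (∫ s in (0:ℝ)..η, u s) ∧ ∀ t ∈ Icc 0 T, gammaBVP T η α * c₀ ≤ u t := by
  have hT : 0 < T := hη0.trans hηT
  choose u huc hu hubc hub using fun n : ℕ => exists_delay_solution_bvp hη0 hηT hα0 hp hA hA0 hg
    hg0 hc₀ hc hm₀ hm₀' hm₁ hm₁' (Nat.one_div_pos_of_nat (α := ℝ) (n := n))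
  set d : ℕ → ℝ := fun n => 1 / ((n : ℝ) + 1) with hd
  have hdelay : ∀ n, ∀ s ∈ Icc 0 T, max (s - d n) 0 ∈ Icc 0 T := fun n s hs => by
    have : 0 < d n := Nat.one_div_pos_of_nat
    exact ⟨le_max_right _ _, max_le (by linarith [hs.2]) hT.le⟩
  have hycont : ∀ n, Continuous fun s => A s * g (u n (max (s - d n) 0)) := fun n => by
    have := huc n
    fun_prop
  obtain ⟨B, hB⟩ := (isCompact_Icc.prod isCompact_Icc).exists_bound_of_continuousOn
    (s := Icc 0 T ×ˢ Icc (gammaBVP T η α * c₀) c₁) (f := fun p : ℝ × ℝ => A p.1 * g p.2)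
    (by fun_prop)
  have hyB : ∀ n, ∀ s ∈ Icc 0 T, |A s * g (u n (max (s - d n) 0))| ≤ B := fun n s hs =>
    hB (s, _) ⟨hs, hub n _ (hdelay n s hs)⟩
  obtain ⟨φ, hφ, v, hvc, hv⟩ := exists_uniform_limit_of_lipschitz hT.le huc hub (K := B * T)
    fun n r hr t ht => by
      rw [hu n t ht, hu n r hr, sub_sub_sub_cancel_left, abs_sub_comm]
      exact abs_volterra_sub_le (hycont n) (hyB n) hr ht
  have hlim : ∀ t ∈ Icc 0 T, Tendsto (fun n => u (φ n) t) atTop (nhds (v t)) :=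
    fun t ht => hv.tendsto_at ht
  have hylim : ∀ s ∈ Icc 0 T, Tendsto
      (fun n => A s * g (u (φ n) (max (s - d (φ n)) 0))) atTop (nhds (A s * g (v s))) := by
    intro s hs
    have h1 : Tendsto (fun n => max (s - d (φ n)) 0) atTop (nhds s) := by
      have h2 : Tendsto (fun n => d (φ n)) atTop (nhds 0) :=
        tendsto_one_div_add_atTop_nhds_zero_nat.comp hφ.tendsto_atTop
      have h3 := (h2.const_sub s).max (tendsto_const_nhds (x := (0:ℝ)))
      rwa [sub_zero, max_eq_left hs.1] at h3
    have h4 := hv.tendsto_comp hvc.continuousWithinAt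
      (tendsto_nhdsWithin_iff.2 ⟨h1, Eventually.of_forall fun n => hdelay (φ n) s hs⟩)
    exact ((hg.tendsto _).comp h4).const_mul _
  refine ⟨v, hvc, fun t ht => ?_, ?_, fun t ht => ?_⟩
  · refine tendsto_nhds_unique (hlim t ht) ?_
    refine Tendsto.congr (fun n => (hu (φ n) t ht).symm) ?_
    refine (hlim 0 ⟨le_rfl, hT.le⟩).sub (tendsto_volterra ht.1 (fun n => hycont (φ n))
      (fun n s hs => hyB (φ n) s ⟨hs.1, hs.2.trans ht.2⟩)
      fun s hs => hylim s ⟨hs.1, hs.2.trans ht.2⟩)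
  · refine tendsto_nhds_unique (hlim T ⟨hT.le, le_rfl⟩) ?_
    refine Tendsto.congr (fun n => (hubc (φ n)).symm) (Tendsto.const_mul α ?_)
    have hsub : ∀ s ∈ uIoc 0 η, s ∈ Icc 0 T := fun s hs => by
      rw [uIoc_of_le hη0.le] at hs
      exact ⟨hs.1.le, hs.2.trans hηT.le⟩
    refine intervalIntegral.tendsto_integral_filter_of_dominated_convergence
      (fun _ => max |gammaBVP T η α * c₀| |c₁|)
      (Eventually.of_forall fun n => (huc (φ n)).aestronglyMeasurable)
      (Eventually.of_forall fun n => Eventually.of_forall fun s hs => ?_)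
      intervalIntegrable_const (Eventually.of_forall fun s hs => hlim s (hsub s hs))
    have := hub (φ n) s (hsub s hs)
    exact abs_le_max_abs_abs this.1 this.2
  · exact ge_of_tendsto' (hlim t ht) fun n => (hub (φ n) t ht).1

theorem stmt_15 (T η α : ℝ) (hη0 : 0 < η) (hηT : η < T)
    (hα0 : 0 < α) (hα1 : α < 1 / η)
    (f a : ℝ → ℝ)
    (hfc : ContinuousOn f (Ici 0)) (hfnn : ∀ x ∈ Ici (0:ℝ), 0 ≤ f x)
    (hac : ContinuousOn a (Icc 0 T)) (hann : ∀ t ∈ Icc (0:ℝ) T, 0 ≤ a t)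
    (hapos : ∃ t₀ ∈ Icc (0:ℝ) T, 0 < a t₀)
    (θ₁ α₁ : ℝ) (hθ₁0 : 0 < θ₁) (hθ₁1 : θ₁ ≤ 1)
    (hα₁0 : 0 ≤ α₁) (hα₁1 : α₁ < θ₁ * lambda1 T η α a)
    (hf0 : Tendsto (fun x => f x / x) (nhdsWithin 0 (Ioi 0)) (nhds α₁))
    (θ₂ β₁ : ℝ) (hθ₂ : 1 ≤ θ₂)
    (hβ₁ : θ₂ / gammaBVP T η α * lambda2 T η α a < β₁)
    (hfinf : Tendsto (fun x => f x / x) atTop (nhds β₁)) :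
    ∃ u : ℝ → ℝ, IsPosSol T η α f a u := by
  have hT : 0 < T := hη0.trans hηT
  have hp : α * η < 1 := (lt_div_iff₀ hη0).1 hα1
  have hγ : 0 < gammaBVP T η α :=
    div_pos (mul_pos (mul_pos hα0 hη0) (by linarith)) (by nlinarith)
  have hγ1 : gammaBVP T η α ≤ 1 := by
    unfold gammaBVP
    rw [div_le_one (by nlinarith)]
    nlinarith
  set A : ℝ → ℝ := IccExtend hT.le ((Icc 0 T).domRestrict a) with hAdef
  have hA : Continuous A := hac.domRestrict.Icc_extend'
  have hAa : ∀ t ∈ Icc 0 T, A t = a t := fun t ht => IccExtend_of_mem _ _ ht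
  have hA0 : ∀ s, 0 ≤ A s := fun s => hann _ (projIcc 0 T hT.le s).2
  set g : ℝ → ℝ := fun x => f (max x 0) with hgdef
  have hg : Continuous g := hfc.comp_continuous (by fun_prop) fun x =>
    mem_Ici.2 (le_max_right _ _)
  have hg0 : ∀ x, 0 ≤ g x := fun x => hfnn _ (mem_Ici.2 (le_max_right _ _))
  have hgf : ∀ x, 0 ≤ x → g x = f x := fun x hx => by rw [hgdef]; simp only [max_eq_left hx]
  have hL1 : lambda1 T η α a = (1 - α * η) / volterra A T := by
    unfold lambda1 volterra
    congr 1
    refine intervalIntegral.integral_congr fun s hs => ?_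
    rw [uIcc_of_le hT.le] at hs
    simp only [hAa s hs]
  have hL2 : lambda2 T η α a = (1 - α * η) / (gammaBVP T η α * weightIntegral T η α A) := by
    unfold lambda2 weightIntegral
    congr 3
    · refine intervalIntegral.integral_congr fun s hs => ?_
      rw [uIcc_of_le hηT.le] at hs
      simp only [hAa s ⟨hη0.le.trans hs.1, hs.2⟩]
    · congr 1
      refine intervalIntegral.integral_congr fun s hs => ?_
      rw [uIcc_of_le hη0.le] at hs
      simp only [hAa s ⟨hs.1, hs.2.trans hηT.le⟩]
  have hL1pos : 0 < lambda1 T η α a := pos_of_mul_pos_right (hα₁0.trans_lt hα₁1) hθ₁0.le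
  have hV : 0 < volterra A T := by
    rw [hL1] at hL1pos
    exact (div_pos_iff_of_pos_left (by linarith)).1 hL1pos
  have hW : 0 < weightIntegral T η α A :=
    (mul_pos (div_pos (by linarith) hT) hV).trans_le
      (volterra_le_weightIntegral hη0 hηT hα0 hA hA0)
  obtain ⟨k, hk, hk'⟩ := exists_between hα₁1
  have hkV : k * volterra A T ≤ 1 - α * η := by
    have : k < lambda1 T η α a := hk'.trans_le (mul_le_of_le_one_left hL1pos.le hθ₁1)
    rw [hL1, lt_div_iff₀ hV] at this
    exact this.le
  obtain ⟨b, hb, hb'⟩ := exists_between hβ₁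
  have hbW : 1 - α * η < b * gammaBVP T η α * weightIntegral T η α A := by
    rw [hL2, div_mul_div_comm, div_lt_iff₀ (by positivity)] at hb
    have h1 : 1 - α * η ≤ θ₂ * (1 - α * η) := le_mul_of_one_le_left (by linarith) hθ₂
    have h2 : 0 < b * gammaBVP T η α * weightIntegral T η α A := by
      refine pos_of_mul_pos_right (b := b * gammaBVP T η α * weightIntegral T η α A) ?_ hγ.le
      linarith
    nlinarith
  have hb0 : 0 < b := by
    by_contra! hcon
    have := mul_nonneg (mul_nonneg (neg_nonneg.2 hcon) hγ.le) hW.le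
    nlinarith
  obtain ⟨δ, hδ, hδf⟩ := (mem_nhdsGT_iff_exists_Ioc_subset).1 (hf0.eventually_lt_const hk)
  have hδ0 : 0 < δ := hδ
  have hfk : ∀ x, 0 < x → x ≤ δ → f x ≤ k * x := fun x hx hxδ =>
    ((div_lt_iff₀ hx).1 (hδf ⟨hx, hxδ⟩)).le
  have hf00 : f 0 ≤ 0 := by
    have h1 : Tendsto f (nhdsWithin 0 (Ioi 0)) (nhds (f 0)) :=
      (hfc 0 self_mem_Ici).mono_left (nhdsWithin_mono _ Ioi_subset_Ici_self)
    have h2 : Tendsto (fun x => k * x) (nhdsWithin 0 (Ioi 0)) (nhds 0) :=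
      (Continuous.tendsto' (by fun_prop) _ _ (mul_zero k)).mono_left nhdsWithin_le_nhds
    refine le_of_tendsto_of_tendsto h1 h2 ?_
    filter_upwards [Ioc_mem_nhdsGT hδ0] with x hx using hfk x hx.1 hx.2
  have hk0 : 0 ≤ k := hα₁0.trans hk.le
  obtain ⟨R, hR⟩ := eventually_atTop.1
    ((hfinf.eventually_const_lt hb').and (eventually_gt_atTop 0))
  obtain ⟨u, huc, hu, hubc, hupos⟩ := exists_solution_bvp hη0 hηT hα0 hp hA hA0 hg hg0 hδ0
    (le_max_left δ (R / gammaBVP T η α)) (m₀ := k) (m₁ := b * gammaBVP T η α)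
    (fun x hx => by
      rcases le_or_gt x 0 with h | h
      · simp only [hgdef, max_eq_right h]
        exact hf00.trans (by positivity)
      · rw [hgf x h.le]
        exact (hfk x h hx).trans (mul_le_mul_of_nonneg_left hx hk0)) hkV
    (fun x hx => by
      have hRx : R ≤ x := by
        refine le_trans ?_ hx
        rw [← div_le_iff₀' hγ]
        exact le_max_right _ _
      obtain ⟨h1, h2⟩ := hR x hRx
      rw [hgf x h2.le, mul_assoc]
      exact (mul_le_mul_of_nonneg_left hx hb0.le).trans ((lt_div_iff₀ h2).1 h1).le) hbW
  have hpos : ∀ t ∈ Icc 0 T, 0 < u t := fun t ht => (mul_pos hγ hδ0).trans_le (hupos t ht)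
  have hy : Continuous fun s => A s * g (u s) := by fun_prop
  refine ⟨u, hpos, fun t => -∫ s in (0:ℝ)..t, A s * g (u s), fun t => -(A t * g (u t)),
    fun t ht => ?_, fun t _ => ?_, fun t ht => ?_, by simp, hubc⟩
  · exact ((hasDerivAt_volterra hy t).const_sub (u 0)).hasDerivWithinAt.congr hu (hu t ht)
  · exact (hy.integral_hasStrictDerivAt 0 t).hasDerivAt.neg.hasDerivWithinAt
  · have ht' := Ioo_subset_Icc_self ht
    simp only [hAa t ht', hgf _ (hpos t ht').le]
    ring
end
end
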